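/- Assume Conditions B1–B2. There exist constants c₀, c₁, b₀ and ε₀ > 0 such that for every ε ∈ (0, ε₀], every b > b₀, and every finite (ε/b)-regular discretization T̃ of T: (i) P( sup_{t∈T̃} f(t) < b | sup_{t∈T} f(t) > b ) ≤ c₀ √ε, and (ii) the cardinality of T̃ satisfies #(T̃) ≤ c₁ m(T) ε^{−d} b^d. -/

import Mathlib

open MeasureTheory ProbabilityTheory Filter
open scoped Classical

noncomputable section

/-- The ℓ¹ norm `|x| = ∑ⱼ |xⱼ|` on `ℝ^d`. -/
def nrm {d : ℕ} (x : Fin d → ℝ) : ℝ := ∑ j, |x j|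

/-- `S` is a `θ`-regular discretization of `T`: its points are `θ`-separated and every
point of `T` is within distance `2θ` of `S`. -/
def IsRegularDiscretization {d : ℕ} (T : Set (Fin d → ℝ)) (θ : ℝ)
    (S : Finset (Fin d → ℝ)) : Prop :=
  ↑S ⊆ T ∧ (∀ s ∈ S, ∀ t ∈ S, s ≠ t → θ ≤ nrm (s - t)) ∧
    ∀ t ∈ T, ∃ s ∈ S, nrm (s - t) ≤ 2 * θ

section GaussianBounds

open Real

lemma gaussianReal_le_mul_volume {C : ℝ} {s : Set ℝ}
    (h : ∀ x ∈ s, gaussianPDFReal 0 1 x ≤ C) (hs : MeasurableSet s) :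
    gaussianReal 0 1 s ≤ ENNReal.ofReal C * volume s := by
  rw [gaussianReal_apply 0 one_ne_zero]
  calc ∫⁻ x in s, gaussianPDF 0 1 x ≤ ∫⁻ _ in s, ENNReal.ofReal C :=
        setLIntegral_mono' hs fun x hx => ENNReal.ofReal_le_ofReal (h x hx)
    _ = _ := by simp

lemma gaussianPDFReal_le_exp_mul (b x : ℝ) :
    gaussianPDFReal 0 1 x ≤ gaussianPDFReal 0 1 b * exp (b * (b - x)) := by
  simp only [gaussianPDFReal, NNReal.coe_one, mul_one, sub_zero]
  rw [mul_assoc, ← exp_add]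
  gcongr
  nlinarith [sq_nonneg (x - b)]

/-- Mills-type upper bound for a centered Gaussian variable of variance at most `4 - D`. -/
lemma gaussianReal_Ioi_two_mul_le {v : NNReal} {D b : ℝ} (hD : 0 ≤ D) (hv : (v : ℝ) = 4 - D)
    (hb : 0 < b) :
    gaussianReal 0 v (Set.Ioi (2 * b)) ≤
      ENNReal.ofReal (gaussianPDFReal 0 1 b / b * exp (-(b ^ 2 * D / 8))) := by
  rcases eq_or_ne v 0 with rfl | hv0
  · simp [gaussianReal_zero_var, hb.le]
  have hvpos : (0 : ℝ) < v := by
    have := pos_iff_ne_zero.2 hv0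
    exact_mod_cast this
  obtain ⟨w, hw⟩ : ∃ w : ℝ, (v : ℝ) = w := ⟨_, rfl⟩
  rw [hw] at hv hvpos
  have hw4 : w ≤ 4 := by linarith
  rw [gaussianReal_apply 0 hv0]
  set A : ℝ := (√(2 * π * w))⁻¹ * exp (2 * b ^ 2 / w) with hA
  have hApos : 0 ≤ A := by positivity
  have ha : -(2 * b / w) < 0 := by
    have : 0 < 2 * b / w := by positivity
    linarith
  have hle : ∀ x, gaussianPDFReal 0 v x ≤ A * exp (-(2 * b / w) * x) := by
    intro x
    simp only [gaussianPDFReal, sub_zero, hw]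
    rw [hA, mul_assoc (√(2 * π * w))⁻¹, ← exp_add]
    gcongr
    have : -(x ^ 2) / (2 * w) ≤ 2 * b ^ 2 / w + -(2 * b / w) * x ↔
        -(x ^ 2) / (2 * w) ≤ (4 * b ^ 2 - 4 * b * x) / (2 * w) := by
      rw [show 2 * b ^ 2 / w + -(2 * b / w) * x = (4 * b ^ 2 - 4 * b * x) / (2 * w) by
        field_simp; ring]
    rw [this]
    gcongr
    nlinarith [sq_nonneg (x - 2 * b)]
  calc ∫⁻ x in Set.Ioi (2 * b), gaussianPDF 0 v x
      ≤ ∫⁻ x in Set.Ioi (2 * b), ENNReal.ofReal (A * exp (-(2 * b / w) * x)) :=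
        lintegral_mono fun x => ENNReal.ofReal_le_ofReal (hle x)
    _ = ENNReal.ofReal (∫ x in Set.Ioi (2 * b), A * exp (-(2 * b / w) * x)) := by
        rw [ofReal_integral_eq_lintegral_ofReal]
        · exact (integrableOn_exp_mul_Ioi ha _).const_mul A
        · exact ae_of_all _ fun x => by positivity
    _ ≤ _ := by
        apply ENNReal.ofReal_le_ofReal
        rw [integral_const_mul, integral_exp_mul_Ioi ha]
        have h1 : A * (-exp (-(2 * b / w) * (2 * b)) / -(2 * b / w)) =
            (√(2 * π * w))⁻¹ * (w / (2 * b)) * exp (-(2 * b ^ 2 / w)) := by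
          rw [hA, show -(2 * b / w) * (2 * b) = -(2 * b ^ 2 / w) - 2 * b ^ 2 / w by
            field_simp; ring, exp_sub]
          have := exp_pos (2 * b ^ 2 / w)
          field_simp
        rw [h1]
        simp only [gaussianPDFReal, NNReal.coe_one, mul_one, sub_zero]
        have h2 : (√(2 * π * w))⁻¹ * (w / (2 * b)) ≤ (√(2 * π))⁻¹ / b := by
          rw [sqrt_mul (by positivity), mul_inv]
          have hs : √w ≤ 2 := by
            rw [show (2 : ℝ) = √4 by rw [show (4 : ℝ) = 2 ^ 2 by norm_num]; simp]
            exact sqrt_le_sqrt hw4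
          have hsp : 0 < √w := sqrt_pos.2 hvpos
          have h3 : (√w)⁻¹ * (w / (2 * b)) ≤ 1 / b := by
            have : (√w)⁻¹ * (w / (2 * b)) = √w / (2 * b) := by
              nth_rewrite 2 [← mul_self_sqrt hvpos.le]
              field_simp
            rw [this, div_le_div_iff₀ (by positivity) hb]
            nlinarith
          calc _ = (√(2 * π))⁻¹ * ((√w)⁻¹ * (w / (2 * b))) := by ring
            _ ≤ (√(2 * π))⁻¹ * (1 / b) := by gcongr
            _ = _ := by ring
        have h4 : exp (-(2 * b ^ 2 / w)) ≤ exp (-b ^ 2 / 2) * exp (-(b ^ 2 * D / 8)) := by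
          rw [← exp_add]
          gcongr
          have : b ^ 2 / 2 + b ^ 2 * D / 8 ≤ 2 * b ^ 2 / w := by
            rw [le_div_iff₀ hvpos, hv]
            nlinarith [sq_nonneg (b * D), sq_nonneg b]
          linarith
        calc _ ≤ ((√(2 * π))⁻¹ / b) * (exp (-b ^ 2 / 2) * exp (-(b ^ 2 * D / 8))) := by gcongr
          _ = _ := by ring

lemma le_gaussianReal_Ioi {b : ℝ} (hb : 1 ≤ b) :
    ENNReal.ofReal (exp (-(3 / 2)) * (gaussianPDFReal 0 1 b / b)) ≤
      gaussianReal 0 1 (Set.Ioi b) := by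
  have hb0 : 0 < b := by linarith
  have h1b : 1 / b ≤ 1 := by rw [div_le_one hb0]; exact hb
  calc ENNReal.ofReal (exp (-(3 / 2)) * (gaussianPDFReal 0 1 b / b))
      = ∫⁻ _ in Set.Ioc b (b + 1 / b),
          ENNReal.ofReal (exp (-(3 / 2)) * gaussianPDFReal 0 1 b) := by
        simp only [lintegral_const, MeasurableSet.univ, Measure.restrict_apply, Set.univ_inter,
          volume_Ioc, add_sub_cancel_left]
        rw [← ENNReal.ofReal_mul (mul_nonneg (exp_pos _).le (gaussianPDFReal_nonneg _ _ _))]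
        congr 1; ring
    _ ≤ ∫⁻ x in Set.Ioc b (b + 1 / b), gaussianPDF 0 1 x := by
        refine setLIntegral_mono' measurableSet_Ioc fun x hx => ENNReal.ofReal_le_ofReal ?_
        simp only [gaussianPDFReal, NNReal.coe_one, mul_one, sub_zero]
        rw [mul_left_comm, ← exp_add]
        gcongr
        have h2 : b * (1 / b) = 1 := by field_simp
        have h3 : 0 < 1 / b := by positivity
        nlinarith [hx.1, hx.2]
    _ ≤ ∫⁻ x in Set.Ioi b, gaussianPDF 0 1 x := lintegral_mono_set Set.Ioc_subset_Ioi_self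
    _ = _ := (gaussianReal_apply 0 one_ne_zero _).symm

/-- A centered Gaussian variable giving mass at least `1 / 2` to `[-x, x]` has standard deviation
at most `2 x`. -/
lemma variance_le_of_half_le_gaussianReal {v : NNReal} {x : ℝ} (hx : 0 ≤ x)
    (h : 2⁻¹ ≤ gaussianReal 0 v (Set.Icc (-x) x)) : (v : ℝ) ≤ (2 * x) ^ 2 := by
  rcases eq_or_ne v 0 with rfl | hv0
  · simp; positivity
  have hvpos : (0 : ℝ) < v := by
    have := pos_iff_ne_zero.2 hv0
    exact_mod_cast this
  have h1 : gaussianReal 0 v (Set.Icc (-x) x) ≤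
      ENNReal.ofReal ((√(2 * π * v))⁻¹ * (2 * x)) := by
    rw [gaussianReal_apply 0 hv0]
    calc ∫⁻ y in Set.Icc (-x) x, gaussianPDF 0 v y
        ≤ ∫⁻ _ in Set.Icc (-x) x, ENNReal.ofReal (√(2 * π * v))⁻¹ := by
          refine lintegral_mono fun y => ENNReal.ofReal_le_ofReal ?_
          simp only [gaussianPDFReal, sub_zero]
          refine mul_le_of_le_one_right (by positivity) (exp_le_one_iff.2 ?_)
          have : 0 ≤ y ^ 2 / (2 * v) := by positivity
          rw [neg_div]; linarith
      _ = _ := by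
          rw [ENNReal.ofReal_mul (by positivity)]
          simp only [lintegral_const, MeasurableSet.univ, Measure.restrict_apply, Set.univ_inter,
            volume_Icc]
          congr 2; ring
  have h2 : (2 : ℝ)⁻¹ ≤ (√(2 * π * v))⁻¹ * (2 * x) := by
    have := h.trans h1
    rw [show (2 : ENNReal)⁻¹ = ENNReal.ofReal 2⁻¹ by
      rw [ENNReal.ofReal_inv_of_pos (by norm_num)]; simp] at this
    exact (ENNReal.ofReal_le_ofReal_iff (by positivity)).1 this
  have hs : 0 < √(2 * π * v) := by positivity
  have h3 : √(2 * π * v) ≤ 4 * x := by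
    rw [inv_mul_eq_div, le_div_iff₀ hs] at h2
    linarith
  have h4 : 2 * π * v ≤ (4 * x) ^ 2 := by
    calc 2 * π * v = √(2 * π * v) ^ 2 := (sq_sqrt (by positivity)).symm
      _ ≤ _ := by gcongr
  nlinarith [pi_gt_three]

end GaussianBounds

section LinearCrossing

/-- The set of `x` for which one of the lines `r i * x + u i` exceeds `b` while all the nearby lines
`q i * x + v i` stay below `b` is short, hence has small Gaussian measure. -/
lemma gaussianReal_crossing_le {ι : Type*} {b η A k : ℝ} (hb : 1 ≤ b) (hη : 0 ≤ η) (hη1 : η ≤ 1)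
    (hA : 0 ≤ A) (hk : 0 ≤ k) {r q u v : ι → ℝ}
    (hr : ∀ i, 1 / 2 ≤ r i) (hr1 : ∀ i, r i ≤ 1) (hq : ∀ i, 1 / 2 ≤ q i)
    (hrq : ∀ i, |r i - q i| ≤ A * η / b ^ 2) (hu : ∀ i, |u i| ≤ k / b)
    (huv : ∀ i, |u i - v i| ≤ k * η / b) :
    gaussianReal 0 1 {x | (∃ i, b < r i * x + u i) ∧ ∀ i, q i * x + v i < b} ≤
      ENNReal.ofReal (4 * (4 * A + 1) * (η * (gaussianPDFReal 0 1 b / b)) * Real.exp (3 * k)) := by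
  have hb0 : 0 < b := by linarith
  set E : Set ℝ := {x | (∃ i, b < r i * x + u i) ∧ ∀ i, q i * x + v i < b} with hE
  set φ := gaussianPDFReal 0 1 b with hφ
  have hφ0 : 0 ≤ φ := gaussianPDFReal_nonneg _ _ _
  have hkb : 0 ≤ k / b := by positivity
  have hkb' : k * η / b ≤ k / b := by
    gcongr; exact mul_le_of_le_one_right hk hη1
  have hlow : ∀ x ∈ E, b - 2 * (k / b) ≤ x := by
    rintro x ⟨⟨i, hi⟩, -⟩
    have h1 := hu i
    rw [abs_le] at h1
    by_contra! hx
    have h3 : 0 ≤ r i * (b - x) - (b - x) / 2 := by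
      have : 0 ≤ (r i - 1 / 2) * (b - x) := mul_nonneg (by linarith [hr i]) (by linarith)
      linarith
    have h4 : r i * b ≤ b := mul_le_of_le_one_left hb0.le (hr1 i)
    linarith
  have hup : ∀ x ∈ E, x ≤ 2 * b + 4 * (k / b) := by
    rintro x ⟨⟨i, -⟩, hx⟩
    have h0 := hx i
    have h1 := hu i
    have h2 := huv i
    rw [abs_le] at h1 h2
    by_contra! hx'
    have h3 : 0 ≤ (q i - 1 / 2) * x := mul_nonneg (by linarith [hq i]) (by linarith)
    linarith
  set δ : ℝ := η / b * ((1 + k) * (4 * A + 1)) with hδ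
  have hδ0 : 0 ≤ δ := by positivity
  have hdiff : ∀ x ∈ E, ∀ y ∈ E, x ≤ y → y - x ≤ 2 * δ := by
    rintro x ⟨⟨i, hi⟩, -⟩ y hy hxy
    have h1 := hy.2 i
    have h2 := huv i
    rw [abs_le] at h2
    have habs : |y| ≤ 2 * b + 4 * (k / b) :=
      abs_le.2 ⟨by linarith [hlow y hy], hup y hy⟩
    have h3 : (r i - q i) * y ≤ A * η / b ^ 2 * (2 * b + 4 * (k / b)) := by
      calc (r i - q i) * y ≤ |(r i - q i) * y| := le_abs_self _
        _ = |r i - q i| * |y| := abs_mul _ _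
        _ ≤ _ := by
          have := hrq i
          gcongr
    have h4 : A * η / b ^ 2 * (2 * b + 4 * (k / b)) ≤ η / b * (A * (2 + 4 * k)) := by
      have : 2 * b + 4 * (k / b) ≤ b * (2 + 4 * k) := by
        have : k / b ≤ b * k := by
          rw [div_le_iff₀ hb0]
          nlinarith [mul_le_mul hb hb zero_le_one hb0.le]
        linarith
      calc _ ≤ A * η / b ^ 2 * (b * (2 + 4 * k)) := by gcongr
        _ = _ := by field_simp
    have h5 : 0 ≤ (r i - 1 / 2) * (y - x) := mul_nonneg (by linarith [hr i]) (by linarith)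
    have h6 : η / b * (A * (2 + 4 * k)) + k * η / b ≤ δ := by
      rw [hδ, show k * η / b = η / b * k by ring, ← mul_add]
      gcongr
      nlinarith [mul_nonneg hA hk]
    linarith
  rcases E.eq_empty_or_nonempty with h | ⟨x₁, hx₁⟩
  · rw [h]; simp
  have hsub : E ⊆ Set.Icc (x₁ - 2 * δ) (x₁ + 2 * δ) ∩ Set.Ici (b - 2 * (k / b)) := by
    intro x hx
    refine ⟨?_, hlow x hx⟩
    rcases le_total x x₁ with h | h
    · exact ⟨by linarith [hdiff x hx x₁ hx₁ h], by linarith⟩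
    · exact ⟨by linarith, by linarith [hdiff x₁ hx₁ x hx h]⟩
  have hpdf : ∀ x ∈ Set.Icc (x₁ - 2 * δ) (x₁ + 2 * δ) ∩ Set.Ici (b - 2 * (k / b)),
      gaussianPDFReal 0 1 x ≤ φ * Real.exp (2 * k) := by
    rintro x ⟨-, hx⟩
    refine (gaussianPDFReal_le_exp_mul b x).trans ?_
    have : b * (k / b) = k := by field_simp
    have hx' : b - x ≤ 2 * (k / b) := by
      have : b - 2 * (k / b) ≤ x := hx
      linarith
    have h2 := mul_le_mul_of_nonneg_left hx' hb0.le
    refine mul_le_mul_of_nonneg_left (Real.exp_le_exp.2 ?_) hφ0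
    linarith
  calc gaussianReal 0 1 E ≤ _ := measure_mono hsub
    _ ≤ ENNReal.ofReal (φ * Real.exp (2 * k)) *
        volume (Set.Icc (x₁ - 2 * δ) (x₁ + 2 * δ) ∩ Set.Ici (b - 2 * (k / b))) :=
      gaussianReal_le_mul_volume hpdf (measurableSet_Icc.inter measurableSet_Ici)
    _ ≤ ENNReal.ofReal (φ * Real.exp (2 * k)) * volume (Set.Icc (x₁ - 2 * δ) (x₁ + 2 * δ)) := by
      gcongr; exact Set.inter_subset_left
    _ = ENNReal.ofReal (φ * Real.exp (2 * k) * (4 * δ)) := by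
      rw [Real.volume_Icc, ← ENNReal.ofReal_mul (by positivity)]
      congr 2; ring
    _ ≤ _ := by
      apply ENNReal.ofReal_le_ofReal
      have h1 : (1 + k) ≤ Real.exp k := by linarith [Real.add_one_le_exp k]
      calc φ * Real.exp (2 * k) * (4 * δ)
          = 4 * (4 * A + 1) * (η * (φ / b)) * ((1 + k) * Real.exp (2 * k)) := by
            rw [hδ]; ring
        _ ≤ 4 * (4 * A + 1) * (η * (φ / b)) * (Real.exp k * Real.exp (2 * k)) := by gcongr
        _ = _ := by rw [← Real.exp_add]; congr 2; ring

variable {Ω : Type*} [MeasurableSpace Ω] {P : Measure Ω} [IsProbabilityMeasure P]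

/-- Randomised version of `gaussianReal_crossing_le`, with intercepts independent of the Gaussian
variable `ξ`. -/
lemma measure_crossing_le {ι : Type*} [Fintype ι] {b η A : ℝ} (hb : 1 ≤ b) (hη : 0 ≤ η)
    (hη1 : η ≤ 1) (hA : 0 ≤ A) {r q : ι → ℝ}
    (hr : ∀ i, 1 / 2 ≤ r i) (hr1 : ∀ i, r i ≤ 1) (hq : ∀ i, 1 / 2 ≤ q i)
    (hrq : ∀ i, |r i - q i| ≤ A * η / b ^ 2)
    {ξ : Ω → ℝ} {Y : Ω → (ι ⊕ ι → ℝ)} (hξ : AEMeasurable ξ P) (hY : AEMeasurable Y P)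
    (hlaw : P.map ξ = gaussianReal 0 1) (hind : IndepFun ξ Y P) :
    P {ω | (∃ i, b < r i * ξ ω + Y ω (Sum.inl i) / b) ∧
        ∀ i, q i * ξ ω + (Y ω (Sum.inl i) / b - η / b * Y ω (Sum.inr i)) < b} ≤
      ENNReal.ofReal (4 * (4 * A + 1) * (η * (gaussianPDFReal 0 1 b / b))) *
        ∫⁻ ω, ENNReal.ofReal (Real.exp (3 * ‖Y ω‖)) ∂P := by
  have hb0 : 0 < b := by linarith
  have hφ0 : 0 ≤ gaussianPDFReal 0 1 b := gaussianPDFReal_nonneg _ _ _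
  set S : Set (ℝ × (ι ⊕ ι → ℝ)) := {z | (∃ i, b < r i * z.1 + z.2 (Sum.inl i) / b) ∧
        ∀ i, q i * z.1 + (z.2 (Sum.inl i) / b - η / b * z.2 (Sum.inr i)) < b} with hS
  have hSmeas : MeasurableSet S := by
    have h1 : IsOpen S := by
      rw [hS]
      simp only [Set.ofPred_and, Set.ofPred_exists, Set.ofPred_forall]
      refine (isOpen_iUnion fun i => ?_).inter (isOpen_iInter_of_finite fun i => ?_)
      · exact isOpen_lt (by fun_prop) (by fun_prop)
      · exact isOpen_lt (by fun_prop) (by fun_prop)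
    exact h1.measurableSet
  have : IsProbabilityMeasure (P.map Y) := Measure.isProbabilityMeasure_map hY
  have h1 : P {ω | (∃ i, b < r i * ξ ω + Y ω (Sum.inl i) / b) ∧
        ∀ i, q i * ξ ω + (Y ω (Sum.inl i) / b - η / b * Y ω (Sum.inr i)) < b} =
      ((gaussianReal 0 1).prod (P.map Y)) S := by
    rw [← hlaw, ← (indepFun_iff_map_prod_eq_prod_map_map hξ hY).1 hind,
      Measure.map_apply_of_aemeasurable (hξ.prodMk hY) hSmeas]
    rfl
  rw [h1, Measure.prod_apply_symm hSmeas]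
  rw [← lintegral_map' (f := fun y => ENNReal.ofReal (Real.exp (3 * ‖y‖))) (by fun_prop) hY,
    ← lintegral_const_mul _ (by fun_prop)]
  refine lintegral_mono fun y => ?_
  rw [← ENNReal.ofReal_mul (by positivity)]
  refine gaussianReal_crossing_le (u := fun i => y (Sum.inl i) / b)
    (v := fun i => y (Sum.inl i) / b - η / b * y (Sum.inr i))
    hb hη hη1 hA (norm_nonneg y) hr hr1 hq hrq (fun i => ?_) fun i => ?_
  · rw [abs_div, abs_of_pos hb0]
    gcongr
    exact norm_le_pi_norm y _
  · rw [show y (Sum.inl i) / b - (y (Sum.inl i) / b - η / b * y (Sum.inr i)) =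
      y (Sum.inr i) * η / b by ring, abs_div, abs_mul, abs_of_pos hb0, abs_of_nonneg hη]
    gcongr
    exact norm_le_pi_norm y _

/-- Exponential moments of a centered Gaussian vector are controlled by a quantile of its norm. -/
lemma exists_lintegral_exp_norm_le (a : ℝ) (ha : 0 < a) :
    ∃ M : ℝ, 0 ≤ M ∧ ∀ {Ω : Type} [MeasurableSpace Ω] (P : Measure Ω) [IsProbabilityMeasure P]
      {κ : Type} [Fintype κ] (Y : Ω → (κ → ℝ)), HasGaussianLaw Y P →
      (∀ i, ∫ ω, Y ω i ∂P = 0) → ENNReal.ofReal (3 / 4) ≤ P {ω | ‖Y ω‖ ≤ a} →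
      ∫⁻ ω, ENNReal.ofReal (Real.exp (3 * ‖Y ω‖)) ∂P ≤ ENNReal.ofReal M := by
  set c : ENNReal := ENNReal.ofReal (3 / 4) with hc
  have hc1 : (2 : ENNReal)⁻¹ < c := by
    rw [show (2 : ENNReal)⁻¹ = ENNReal.ofReal 2⁻¹ by
      rw [ENNReal.ofReal_inv_of_pos (by norm_num)]; simp]
    exact (ENNReal.ofReal_lt_ofReal_iff (by norm_num)).2 (by norm_num)
  have hc2 : c < 1 := by
    rw [hc, ← ENNReal.ofReal_one]
    exact (ENNReal.ofReal_lt_ofReal_iff (by norm_num)).2 (by norm_num)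
  set B : ENNReal := ENNReal.ofReal (Real.exp (Fernique.logRatio c)) +
    ∑' n : ℕ, ENNReal.ofReal (Real.exp (-2⁻¹ * Real.log (c / (1 - c)).toReal * 2 ^ n)) with hB
  have hBtop : B ≠ ⊤ := by
    have hcfin : c < ⊤ := hc2.trans ENNReal.one_lt_top
    have hlog : 0 < Real.log (c / (1 - c)).toReal := by
      have h1 : 1 - c = ENNReal.ofReal (1 / 4) := by
        rw [hc, ← ENNReal.ofReal_one, ← ENNReal.ofReal_sub _ (by norm_num)]
        norm_num
      rw [h1, hc, ENNReal.toReal_div, ENNReal.toReal_ofReal (by norm_num),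
        ENNReal.toReal_ofReal (by norm_num)]
      exact Real.log_pos (by norm_num)
    refine ENNReal.add_ne_top.2 ⟨ENNReal.ofReal_ne_top, ?_⟩
    refine (Summable.tsum_ofReal_lt_top <| Real.summable_exp_nat_mul_of_ge ?_
      (fun i ↦ mod_cast (Nat.lt_pow_self (by simp)).le)).ne
    exact mul_neg_of_neg_of_pos (by norm_num) hlog
  set l : ℝ := Fernique.logRatio c * a⁻¹ ^ 2 with hl
  have hlpos : 0 < l := mul_pos (Fernique.logRatio_pos hc1 hc2) (by positivity)
  refine ⟨Real.exp (9 / (4 * l)) * B.toReal, by positivity, ?_⟩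
  intro Ω _ P _ κ _ Y hY hmean hP
  have hG := hY.isGaussian_map
  have hYm : AEMeasurable Y P := hY.aemeasurable
  have hzero : ∀ L : StrongDual ℝ (κ → ℝ), (P.map Y)[L] = 0 := by
    intro L
    rw [integral_map hYm (by fun_prop)]
    have : ∀ ω, L (Y ω) = ∑ i, Y ω i * L (Pi.single i 1) := by
      intro ω
      conv_lhs => rw [pi_eq_sum_univ' (Y ω), map_sum]
      simp
    simp_rw [this]
    rw [integral_finsetSum]
    · simp [integral_mul_const, hmean]
    · intro i _
      exact (hY.eval i).integrable.mul_const _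
  have hrot := IsGaussian.map_rotation_eq_self_of_forall_strongDual_eq_zero hzero (-(Real.pi / 4))
  have hcle : c ≤ (P.map Y) {x | ‖x‖ ≤ a} := by
    rw [Measure.map_apply_of_aemeasurable hYm (measurableSet_le (by fun_prop) (by fun_prop))]
    exact hP
  have key := lintegral_exp_mul_sq_norm_le_of_map_rotation_eq_self hrot hcle hc1
  rw [← hB, ← hl, lintegral_map' (by fun_prop) hYm] at key
  calc ∫⁻ ω, ENNReal.ofReal (Real.exp (3 * ‖Y ω‖)) ∂P
      ≤ ∫⁻ ω, ENNReal.ofReal (Real.exp (9 / (4 * l))) *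
          ENNReal.ofReal (Real.exp (l * ‖Y ω‖ ^ 2)) ∂P := by
        refine lintegral_mono fun ω => ?_
        rw [← ENNReal.ofReal_mul (by positivity), ← Real.exp_add]
        refine ENNReal.ofReal_le_ofReal (Real.exp_le_exp.2 ?_)
        have : 9 / (4 * l) + l * ‖Y ω‖ ^ 2 - 3 * ‖Y ω‖ = (2 * l * ‖Y ω‖ - 3) ^ 2 / (4 * l) := by
          field_simp; ring
        have h2 : 0 ≤ (2 * l * ‖Y ω‖ - 3) ^ 2 / (4 * l) := by positivity
        linarith
    _ = ENNReal.ofReal (Real.exp (9 / (4 * l))) *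
          ∫⁻ ω, ENNReal.ofReal (Real.exp (l * ‖Y ω‖ ^ 2)) ∂P := by
        rw [lintegral_const_mul'' _ (by fun_prop)]
    _ ≤ ENNReal.ofReal (Real.exp (9 / (4 * l))) * B := by gcongr
    _ = _ := by
        rw [ENNReal.ofReal_mul (by positivity), ENNReal.ofReal_toReal hBtop]

end LinearCrossing

section StationaryCurve

variable {E H : Type*} [NormedAddCommGroup E] [NormedAddCommGroup H] {F : E → H}

lemma norm_sub_eq_of_stationary (hF : ∀ s t h, ‖F (s + h) - F (t + h)‖ = ‖F s - F t‖) (s t : E) :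
    ‖F s - F t‖ = ‖F (s - t) - F 0‖ := by
  simpa using hF (s - t) 0 t

variable [NormedSpace ℝ E]

lemma norm_sub_smul_le (hF : ∀ s t h, ‖F (s + h) - F (t + h)‖ = ‖F s - F t‖) (n : ℕ) (h : E) :
    ‖F ((n : ℝ) • h) - F 0‖ ≤ n * ‖F h - F 0‖ := by
  induction n with
  | zero => simp
  | succ n ih =>
    have h1 : ‖F (((n + 1 : ℕ) : ℝ) • h) - F ((n : ℝ) • h)‖ = ‖F h - F 0‖ := by
      have := hF h 0 ((n : ℝ) • h)
      rwa [zero_add, show h + (n : ℝ) • h = ((n + 1 : ℕ) : ℝ) • h by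
        push_cast; rw [add_smul, one_smul, add_comm]] at this
    have h2 := norm_sub_le_norm_sub_add_norm_sub (F (((n + 1 : ℕ) : ℝ) • h)) (F ((n : ℝ) • h)) (F 0)
    push_cast at h1 h2 ⊢
    linarith

/-- Local linear lower bound for a stationary Lipschitz curve near a direction along which it is not
constant. -/
lemma exists_le_norm_sub_of_stationary
    (hF : ∀ s t h, ‖F (s + h) - F (t + h)‖ = ‖F s - F t‖) {C : ℝ} (hC0 : 0 < C)
    (hC : ∀ s t, ‖F s - F t‖ ≤ C * ‖s - t‖) {v : E} {s : ℝ} (hs : 0 < s) (hv : F (s • v) ≠ F 0) :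
    ∃ r > 0, ∃ c > 0, ∃ ρ > 0, ∀ u, ‖u - v‖ < r → ‖u‖ = 1 → ∀ τ, 0 < τ → τ ≤ ρ →
      c * τ ≤ ‖F (τ • u) - F 0‖ := by
  set δ := ‖F (s • v) - F 0‖ with hδ
  have hδ0 : 0 < δ := norm_pos_iff.2 (sub_ne_zero.2 hv)
  refine ⟨δ / (2 * C * s), by positivity, δ / (4 * s), by positivity, δ / (4 * C), by positivity,
    ?_⟩
  intro u hu hu1 τ hτ hτρ
  set n := ⌊s / τ⌋₊ with hn
  have hn1 : (n : ℝ) ≤ s / τ := Nat.floor_le (by positivity)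
  have hn2 : s / τ < n + 1 := Nat.lt_floor_add_one _
  have hn1' : n * τ ≤ s := by rwa [le_div_iff₀ hτ] at hn1
  have hn2' : s < (n + 1) * τ := by rwa [div_lt_iff₀ hτ] at hn2
  have h1 : ‖F (s • v) - F (s • u)‖ ≤ δ / 2 := by
    refine (hC _ _).trans ?_
    rw [← smul_sub, norm_smul, Real.norm_of_nonneg hs.le, norm_sub_rev]
    rw [lt_div_iff₀ (by positivity)] at hu
    nlinarith
  have h2 : ‖F (s • u) - F ((n : ℝ) • (τ • u))‖ ≤ δ / 4 := by
    refine (hC _ _).trans ?_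
    rw [smul_smul, ← sub_smul, norm_smul, hu1, mul_one, Real.norm_of_nonneg (by linarith)]
    rw [le_div_iff₀ (by positivity)] at hτρ
    nlinarith
  have h3 := norm_sub_smul_le hF n (τ • u)
  have h4 : δ ≤ ‖F (s • v) - F (s • u)‖ + ‖F (s • u) - F ((n : ℝ) • (τ • u))‖ +
      ‖F ((n : ℝ) • (τ • u)) - F 0‖ := by
    have e1 := norm_sub_le_norm_sub_add_norm_sub (F (s • v)) (F (s • u)) (F 0)
    have e2 := norm_sub_le_norm_sub_add_norm_sub (F (s • u)) (F ((n : ℝ) • (τ • u))) (F 0)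
    linarith
  have h5 : δ / 4 ≤ n * ‖F (τ • u) - F 0‖ := by linarith
  have h6 : δ / 4 * τ ≤ s * ‖F (τ • u) - F 0‖ := by
    calc δ / 4 * τ ≤ n * ‖F (τ • u) - F 0‖ * τ := by gcongr
      _ = n * τ * ‖F (τ • u) - F 0‖ := by ring
      _ ≤ _ := by gcongr
  calc δ / (4 * s) * τ = δ / 4 * τ / s := by field_simp
    _ ≤ _ := by rw [div_le_iff₀ hs]; linarith

/-- A stationary Lipschitz curve factors through a linear projection, on the range of which its
increments near the origin are bounded below linearly. -/
lemma exists_linearMap_of_stationary [FiniteDimensional ℝ E]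
    (hF : ∀ s t h, ‖F (s + h) - F (t + h)‖ = ‖F s - F t‖) {C : ℝ} (hC0 : 0 < C)
    (hC : ∀ s t, ‖F s - F t‖ ≤ C * ‖s - t‖) :
    ∃ π : E →ₗ[ℝ] E, ∃ c > 0, ∃ ρ > 0, (∀ s h, F (s + h) = F (s + π h)) ∧
      ∀ h, ‖π h‖ ≤ ρ → c * ‖π h‖ ≤ ‖F h - F 0‖ := by
  have hneg : ∀ h, ‖F (-h) - F 0‖ = ‖F h - F 0‖ := fun h => by
    rw [norm_sub_rev, norm_sub_eq_of_stationary hF, sub_neg_eq_add, zero_add]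
  let V : Submodule ℝ E :=
    { carrier := {v | ∀ s : ℝ, F (s • v) = F 0}
      zero_mem' := fun s => by simp
      add_mem' := by
        intro v w hv hw s
        have h1 : ‖F (s • v + s • w) - F (0 + s • w)‖ = 0 := by rw [hF, hv s, sub_self, norm_zero]
        rw [smul_add, sub_eq_zero.1 (norm_eq_zero.1 h1), zero_add, hw s]
      smul_mem' := fun a v hv s => by rw [smul_smul]; exact hv _ }
  obtain ⟨W, hVW⟩ := V.exists_isCompl
  set p := W.projection V hVW.symm with hp
  have hpV : ∀ h, h - p h ∈ V := W.sub_projection_mem hVW.symm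
  have hpW : ∀ h, p h ∈ W := W.projection_apply_mem hVW.symm
  have hcpt : IsCompact (Metric.sphere (0 : E) 1 ∩ W) :=
    (isCompact_sphere 0 1).inter_right W.closed_of_finiteDimensional
  obtain ⟨c, hc, ρ, hρ, hlow⟩ : ∃ c > 0, ∃ ρ > 0, ∀ u ∈ Metric.sphere (0 : E) 1 ∩ W,
      ∀ τ, 0 < τ → τ ≤ ρ → c * τ ≤ ‖F (τ • u) - F 0‖ := by
    refine hcpt.induction_on (p := fun U => ∃ c > 0, ∃ ρ > 0, ∀ u ∈ U,
      ∀ τ, 0 < τ → τ ≤ ρ → c * τ ≤ ‖F (τ • u) - F 0‖) ?_ ?_ ?_ ?_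
    · exact ⟨1, one_pos, 1, one_pos, by simp⟩
    · rintro U U' hUU' ⟨c, hc, ρ, hρ, h⟩
      exact ⟨c, hc, ρ, hρ, fun u hu => h u (hUU' hu)⟩
    · rintro U U' ⟨c, hc, ρ, hρ, h⟩ ⟨c', hc', ρ', hρ', h'⟩
      refine ⟨min c c', lt_min hc hc', min ρ ρ', lt_min hρ hρ', ?_⟩
      rintro u (hu | hu) τ hτ hτρ
      · exact (mul_le_mul_of_nonneg_right (min_le_left _ _) hτ.le).trans
          (h u hu τ hτ (hτρ.trans (min_le_left _ _)))
      · exact (mul_le_mul_of_nonneg_right (min_le_right _ _) hτ.le).trans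
          (h' u hu τ hτ (hτρ.trans (min_le_right _ _)))
    · rintro v ⟨hv1, hvW⟩
      have hvV : v ∉ V := fun hvV => by
        have : v = 0 := Submodule.disjoint_def.1 hVW.disjoint v hvV hvW
        simp [this] at hv1
      obtain ⟨s, hs⟩ : ∃ s : ℝ, F (s • v) ≠ F 0 := by
        by_contra! h
        exact hvV h
      obtain ⟨s', hs', hs'v⟩ : ∃ s' : ℝ, 0 < s' ∧ F (s' • v) ≠ F 0 := by
        rcases lt_trichotomy s 0 with h | h | h
        · refine ⟨-s, by linarith, fun h' => hs ?_⟩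
          have := hneg (s • v)
          rw [← neg_smul, h', sub_self, norm_zero] at this
          exact sub_eq_zero.1 (norm_eq_zero.1 this.symm)
        · simp [h] at hs
        · exact ⟨s, h, hs⟩
      obtain ⟨r, hr, c, hc, ρ, hρ, h⟩ :=
        exists_le_norm_sub_of_stationary hF hC0 hC hs' hs'v
      refine ⟨Metric.ball v r ∩ Metric.sphere 0 1, ?_, c, hc, ρ, hρ, ?_⟩
      · refine mem_nhdsWithin.2 ⟨Metric.ball v r, Metric.isOpen_ball, Metric.mem_ball_self hr, ?_⟩
        exact fun x hx => ⟨hx.1, hx.2.1⟩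
      · rintro u ⟨hu, hu1⟩
        exact h u (by simpa [dist_eq_norm] using hu) (by simpa using hu1)
  have hfac : ∀ s h, F (s + h) = F (s + p h) := fun s h => by
    rw [← sub_eq_zero, ← norm_eq_zero, norm_sub_eq_of_stationary hF, add_sub_add_left_eq_sub]
    have := hpV h 1
    rw [one_smul] at this
    rw [this, sub_self, norm_zero]
  refine ⟨p, c, hc, ρ, hρ, hfac, fun h hh => ?_⟩
  have hfh : F h = F (p h) := by simpa using hfac 0 h
  rw [hfh]
  rcases eq_or_ne (p h) 0 with h0 | h0
  · simp [h0]
  · have hpos : 0 < ‖p h‖ := norm_pos_iff.2 h0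
    have := hlow (‖p h‖⁻¹ • p h) ⟨by simp [norm_smul, hpos.ne'], W.smul_mem _ (hpW h)⟩ _ hpos hh
    rwa [smul_smul, mul_inv_cancel₀ hpos.ne', one_smul] at this

end StationaryCurve

section StationaryField

/-- Centered stationary Gaussian fields with unit variance and locally Lipschitz paths. -/
structure IsStationaryField {Ω E : Type*} [MeasurableSpace Ω] [NormedAddCommGroup E]
    (P : Measure Ω) (f : E → Ω → ℝ) : Prop where
  measurable : ∀ t, Measurable (f t)
  gaussian : IsGaussianProcess f P
  integral_eq_zero : ∀ t, ∫ ω, f t ω ∂P = 0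
  integral_sq : ∀ t, ∫ ω, f t ω ^ 2 ∂P = 1
  integral_sub_sq : ∀ s t h,
    ∫ ω, (f (s + h) ω - f (t + h) ω) ^ 2 ∂P = ∫ ω, (f s ω - f t ω) ^ 2 ∂P
  locallyLipschitz : ∀ᵐ ω ∂P, LocallyLipschitz (f · ω)

/-- A family of random variables all of whose linear combinations are centered Gaussian is a
Gaussian process. -/
lemma isGaussianProcess_of_sum {Ω E : Type*} [MeasurableSpace Ω] {P : Measure Ω} {f : E → Ω → ℝ}
    (hf : ∀ t, Measurable (f t))
    (h : ∀ (n : ℕ) (t : Fin n → E) (c : Fin n → ℝ),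
      ∃ v : NNReal, P.map (fun ω => ∑ i, c i * f (t i) ω) = gaussianReal 0 v) :
    IsGaussianProcess f P := by
  refine ⟨fun I => ⟨isGaussian_of_map_eq_gaussianReal fun L => ?_⟩⟩
  have hm : Measurable fun ω => I.restrict (f · ω) := measurable_pi_lambda _ fun i => hf i
  obtain ⟨v, hv⟩ := h I.card (fun i => (I.equivFin.symm i : E))
    fun i => L (Pi.single (I.equivFin.symm i) 1)
  refine ⟨0, v, ?_⟩
  rw [Measure.map_map L.measurable hm, ← hv]
  congr 1
  ext ω
  simp only [Function.comp_apply]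
  rw [Equiv.sum_comp I.equivFin.symm (fun i => L (Pi.single i 1) * f i ω)]
  conv_lhs => rw [pi_eq_sum_univ' (I.restrict (f · ω)), map_sum]
  simp [mul_comm]

lemma isStationaryField_of_law {Ω E : Type*} [MeasurableSpace Ω] [NormedAddCommGroup E]
    [NormedSpace ℝ E]
    {P : Measure Ω} {f : E → Ω → ℝ} (hf : ∀ t, Measurable (f t))
    (hgauss : ∀ (n : ℕ) (t : Fin n → E) (c : Fin n → ℝ),
      ∃ v : NNReal, P.map (fun ω => ∑ i, c i * f (t i) ω) = gaussianReal 0 v)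
    (hvar : ∫ ω, f 0 ω ^ 2 ∂P = 1)
    (hstat : ∀ (n : ℕ) (t : Fin n → E) (h : E),
      P.map (fun ω (i : Fin n) => f (t i + h) ω) = P.map (fun ω (i : Fin n) => f (t i) ω))
    (hsmooth : ∀ᵐ ω ∂P, ContDiff ℝ 2 (f · ω)) : IsStationaryField P f where
  measurable := hf
  gaussian := isGaussianProcess_of_sum hf hgauss
  integral_eq_zero t := by
    obtain ⟨v, hv⟩ := hgauss 1 (fun _ => t) fun _ => 1
    simp only [Finset.univ_unique, one_mul, Finset.sum_const, Finset.card_singleton, one_smul] at hv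
    have : ∫ x, x ∂(P.map (f t)) = 0 := by rw [hv, integral_id_gaussianReal]
    rwa [integral_map (hf t).aemeasurable (by fun_prop)] at this
  integral_sq t := by
    have key : ∀ t, ∫ ω, f t ω ^ 2 ∂P =
        ∫ x : Fin 1 → ℝ, x 0 ^ 2 ∂(P.map fun ω (_ : Fin 1) => f t ω) := fun t => by
      rw [integral_map (measurable_pi_lambda _ fun _ => hf t).aemeasurable
        ((measurable_pi_apply 0).pow_const 2).aestronglyMeasurable]
    rw [key, ← hvar, key 0, ← hstat 1 (fun _ => 0) t]
    simp
  integral_sub_sq s t h := by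
    have key : ∀ s t, ∫ ω, (f s ω - f t ω) ^ 2 ∂P =
        ∫ x : Fin 2 → ℝ, (x 0 - x 1) ^ 2 ∂(P.map fun ω i => f (![s, t] i) ω) := fun s t => by
      rw [integral_map (measurable_pi_lambda _ fun i => hf _).aemeasurable (by fun_prop)]
      simp
    rw [key, key, ← hstat 2 ![s, t] h]
    congr 2
    ext ω i
    fin_cases i <;> simp
  locallyLipschitz := by
    filter_upwards [hsmooth] with ω hω
    exact (hω.of_le one_le_two).locallyLipschitz

namespace IsStationaryField

variable {Ω E : Type*} [MeasurableSpace Ω] [NormedAddCommGroup E]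
  {P : Measure Ω} {f : E → Ω → ℝ}

lemma memLp (hf : IsStationaryField P f) (t : E) : MemLp (f t) 2 P :=
  (hf.gaussian.hasGaussianLaw_eval t).memLp_two

/-- The field as a curve in `L²`. -/
def curve (hf : IsStationaryField P f) (t : E) : Lp ℝ 2 P := (hf.memLp t).toLp

lemma inner_toLp {u v : Ω → ℝ} (hu : MemLp u 2 P) (hv : MemLp v 2 P) :
    inner ℝ hu.toLp hv.toLp = ∫ ω, u ω * v ω ∂P := by
  rw [L2.inner_def]
  refine integral_congr_ae ?_
  filter_upwards [hu.coeFn_toLp, hv.coeFn_toLp] with ω h1 h2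
  rw [h1, h2]
  simp [mul_comm]

lemma inner_curve (hf : IsStationaryField P f) (s t : E) :
    inner ℝ (hf.curve s) (hf.curve t) = ∫ ω, f s ω * f t ω ∂P := inner_toLp _ _

lemma norm_curve (hf : IsStationaryField P f) (t : E) : ‖hf.curve t‖ = 1 := by
  have := real_inner_self_eq_norm_sq (hf.curve t)
  rw [hf.inner_curve] at this
  simp_rw [← sq] at this
  rw [hf.integral_sq] at this
  nlinarith [norm_nonneg (hf.curve t)]

lemma norm_curve_sub_sq (hf : IsStationaryField P f) (s t : E) :
    ‖hf.curve s - hf.curve t‖ ^ 2 = ∫ ω, (f s ω - f t ω) ^ 2 ∂P := by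
  rw [← real_inner_self_eq_norm_sq, curve, curve, ← MemLp.toLp_sub (hf.memLp s) (hf.memLp t),
    inner_toLp]
  simp [sq]

lemma norm_curve_add_sub (hf : IsStationaryField P f) (s t h : E) :
    ‖hf.curve (s + h) - hf.curve (t + h)‖ = ‖hf.curve s - hf.curve t‖ := by
  rw [← sq_eq_sq₀ (norm_nonneg _) (norm_nonneg _), hf.norm_curve_sub_sq, hf.norm_curve_sub_sq,
    hf.integral_sub_sq]

lemma norm_curve_sub (hf : IsStationaryField P f) (s t : E) :
    ‖hf.curve s - hf.curve t‖ = ‖hf.curve (s - t) - hf.curve 0‖ :=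
  norm_sub_eq_of_stationary hf.norm_curve_add_sub s t

lemma integral_mul (hf : IsStationaryField P f) (s t : E) :
    ∫ ω, f s ω * f t ω ∂P = 1 - ‖hf.curve s - hf.curve t‖ ^ 2 / 2 := by
  rw [norm_sub_sq_real, hf.norm_curve, hf.norm_curve, hf.inner_curve]
  ring

lemma integral_add_sq (hf : IsStationaryField P f) (s t : E) :
    ∫ ω, (f s ω + f t ω) ^ 2 ∂P = 4 - ‖hf.curve s - hf.curve t‖ ^ 2 := by
  have h1 : ∫ ω, (f s ω + f t ω) ^ 2 ∂P = ‖hf.curve s + hf.curve t‖ ^ 2 := by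
    rw [← real_inner_self_eq_norm_sq, curve, curve, ← MemLp.toLp_add (hf.memLp s) (hf.memLp t),
      inner_toLp]
    simp [sq]
  rw [h1, norm_add_sq_real, norm_sub_sq_real, hf.norm_curve, hf.norm_curve]
  ring

lemma ae_eq_of_curve_eq (hf : IsStationaryField P f) {s t : E} (h : hf.curve s = hf.curve t) :
    f s =ᵐ[P] f t := (MemLp.toLp_eq_toLp_iff _ _).1 h

lemma map_eq_gaussianReal_of_integral {u : Ω → ℝ} (hu : HasGaussianLaw u P)
    (h0 : ∫ ω, u ω ∂P = 0) : P.map u = gaussianReal 0 (∫ ω, u ω ^ 2 ∂P).toNNReal := by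
  rw [hu.map_eq_gaussianReal, h0, variance_of_integral_eq_zero hu.aemeasurable h0]

lemma map_eval (hf : IsStationaryField P f) (t : E) : P.map (f t) = gaussianReal 0 1 := by
  rw [map_eq_gaussianReal_of_integral (hf.gaussian.hasGaussianLaw_eval t) (hf.integral_eq_zero t),
    hf.integral_sq]
  simp

lemma map_sub (hf : IsStationaryField P f) (s t : E) : P.map (fun ω => f s ω - f t ω) =
    gaussianReal 0 (‖hf.curve s - hf.curve t‖ ^ 2).toNNReal := by
  rw [map_eq_gaussianReal_of_integral hf.gaussian.hasGaussianLaw_fun_sub, hf.norm_curve_sub_sq]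
  rw [integral_sub ((hf.gaussian.hasGaussianLaw_eval s).integrable)
    ((hf.gaussian.hasGaussianLaw_eval t).integrable)]
  simp [hf.integral_eq_zero]

lemma map_add (hf : IsStationaryField P f) (s t : E) : P.map (fun ω => f s ω + f t ω) =
    gaussianReal 0 (4 - ‖hf.curve s - hf.curve t‖ ^ 2).toNNReal := by
  rw [map_eq_gaussianReal_of_integral hf.gaussian.hasGaussianLaw_fun_add, hf.integral_add_sq]
  rw [integral_add ((hf.gaussian.hasGaussianLaw_eval s).integrable)
    ((hf.gaussian.hasGaussianLaw_eval t).integrable)]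
  simp [hf.integral_eq_zero]

lemma norm_curve_sub_le_two (hf : IsStationaryField P f) (s t : E) :
    ‖hf.curve s - hf.curve t‖ ≤ 2 := by
  have := norm_sub_le (hf.curve s) (hf.curve t)
  rw [hf.norm_curve, hf.norm_curve] at this
  linarith

end IsStationaryField

end StationaryField

namespace IsStationaryField

variable {Ω E : Type*} [MeasurableSpace Ω] [NormedAddCommGroup E] [NormedSpace ℝ E]
  [FiniteDimensional ℝ E] {P : Measure Ω} [IsProbabilityMeasure P] {f : E → Ω → ℝ}

/-- The event that a path is bounded by `K` and `K`-Lipschitz on the ball of radius `R`. -/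
def tameEvent (f : E → Ω → ℝ) (R K : ℝ) : Set Ω :=
  {ω | (∀ s ∈ Metric.closedBall (0 : E) R, |f s ω| ≤ K) ∧
    ∀ s ∈ Metric.closedBall (0 : E) R, ∀ t ∈ Metric.closedBall (0 : E) R,
      |f s ω - f t ω| ≤ K * ‖s - t‖}

lemma exists_le_measure_tameEvent (hf : IsStationaryField P f) (R : ℝ) :
    ∃ K > 0, ENNReal.ofReal (3 / 4) ≤ P (tameEvent f R K) := by
  have hmono : Monotone fun n : ℕ => tameEvent f R n := by
    intro m n hmn ω hω
    have : (m : ℝ) ≤ n := by exact_mod_cast hmn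
    exact ⟨fun s hs => (hω.1 s hs).trans this, fun s hs t ht => (hω.2 s hs t ht).trans
      (mul_le_mul_of_nonneg_right this (norm_nonneg _))⟩
  have hae : ∀ᵐ ω ∂P, ω ∈ ⋃ n : ℕ, tameEvent f R n := by
    filter_upwards [hf.locallyLipschitz] with ω hω
    have hcpt : IsCompact (Metric.closedBall (0 : E) R) := isCompact_closedBall 0 R
    obtain ⟨K, hK⟩ := hω.locallyLipschitzOn.exists_lipschitzOnWith_of_compact hcpt
    obtain ⟨B, hB⟩ := hcpt.exists_bound_of_continuousOn (f := fun t => f t ω)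
      hω.continuous.continuousOn
    obtain ⟨n, hn⟩ := exists_nat_ge (max (K : ℝ) B)
    refine Set.mem_iUnion.2 ⟨n, fun s hs => (hB s hs).trans ((le_max_right _ _).trans hn),
      fun s hs t ht => ?_⟩
    have := hK.dist_le_mul s hs t ht
    rw [Real.dist_eq, dist_eq_norm] at this
    exact this.trans (mul_le_mul_of_nonneg_right ((le_max_left _ _).trans hn) (norm_nonneg _))
  have hone : P (⋃ n : ℕ, tameEvent f R n) = 1 := by
    exact (measure_congr (Filter.eventuallyEq_univ.2 hae)).trans measure_univ
  rw [hmono.measure_iUnion] at hone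
  have hlt : ENNReal.ofReal (3 / 4) < ⨆ n : ℕ, P (tameEvent f R n) := by
    rw [hone, ← ENNReal.ofReal_one]
    exact (ENNReal.ofReal_lt_ofReal_iff one_pos).2 (by norm_num)
  obtain ⟨n, hn⟩ := lt_iSup_iff.1 hlt
  refine ⟨n + 1, by positivity, hn.le.trans (measure_mono ?_)⟩
  have := hmono n.le_succ
  simpa using this

lemma exists_lipschitz_curve (hf : IsStationaryField P f) :
    ∃ C > 0, ∀ s t, ‖hf.curve s - hf.curve t‖ ≤ C * ‖s - t‖ := by
  obtain ⟨K, hK, hP⟩ := hf.exists_le_measure_tameEvent 1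
  refine ⟨2 * K + 2, by positivity, fun s t => ?_⟩
  rw [hf.norm_curve_sub]
  set h := s - t
  have hh0 := norm_nonneg h
  rcases le_or_gt ‖h‖ 1 with hh | hh
  · have h1 : (2 : ENNReal)⁻¹ ≤ gaussianReal 0 (‖hf.curve h - hf.curve 0‖ ^ 2).toNNReal
        (Set.Icc (-(K * ‖h‖)) (K * ‖h‖)) := by
      rw [← hf.map_sub, Measure.map_apply (by have := hf.measurable; fun_prop) measurableSet_Icc]
      calc (2 : ENNReal)⁻¹ = ENNReal.ofReal (1 / 2) := by
            rw [one_div, ENNReal.ofReal_inv_of_pos (by norm_num)]; simp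
        _ ≤ ENNReal.ofReal (3 / 4) := ENNReal.ofReal_le_ofReal (by norm_num)
        _ ≤ _ := hP
        _ ≤ _ := by
          refine measure_mono fun ω hω => ?_
          have := hω.2 h (by simpa using hh) 0 (by simp)
          rw [sub_zero] at this
          exact abs_le.1 this
    have h2 := variance_le_of_half_le_gaussianReal (by positivity) h1
    rw [Real.coe_toNNReal _ (sq_nonneg _)] at h2
    have h3 := (sq_le_sq₀ (norm_nonneg _) (by positivity)).1 h2
    linarith
  · have := hf.norm_curve_sub_le_two h 0
    nlinarith

end IsStationaryField

lemma isGaussianProcess_of_combination {Ω E S : Type*} [MeasurableSpace Ω] {P : Measure Ω}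
    {f : E → Ω → ℝ} (hf : IsGaussianProcess f P) {X : S → Ω → ℝ}
    (h : ∀ k, ∃ (x y z : E) (α β γ : ℝ), ∀ ω, X k ω = α * f x ω + β * f y ω + γ * f z ω) :
    IsGaussianProcess X P := by
  refine hf.of_isGaussianProcess fun k => ?_
  obtain ⟨x, y, z, α, β, γ, hk⟩ := h k
  let I : Finset E := {x, y, z}
  refine ⟨I, α • ContinuousLinearMap.proj (⟨x, by simp [I]⟩ : I) +
    β • ContinuousLinearMap.proj (⟨y, by simp [I]⟩ : I) +
    γ • ContinuousLinearMap.proj (⟨z, by simp [I]⟩ : I), fun ω => ?_⟩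
  rw [hk]
  simp [Finset.restrict]

namespace IsStationaryField

section

variable {Ω E : Type*} [MeasurableSpace Ω] [NormedAddCommGroup E]
  {P : Measure Ω} {f : E → Ω → ℝ}

lemma integral_combination (hf : IsStationaryField P f) (x y z : E) (α β γ : ℝ) :
    ∫ ω, α * f x ω + β * f y ω + γ * f z ω ∂P = 0 := by
  have h : ∀ t, Integrable (f t) P := fun t => (hf.gaussian.hasGaussianLaw_eval t).integrable
  have h2 : Integrable (fun ω => α * f x ω + β * f y ω) P :=
    ((h x).const_mul α).add ((h y).const_mul β)
  rw [integral_add h2 ((h z).const_mul γ), integral_add ((h x).const_mul α) ((h y).const_mul β)]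
  simp [integral_const_mul, hf.integral_eq_zero]

lemma covariance_combination [IsProbabilityMeasure P] (hf : IsStationaryField P f)
    (t x y z : E) (α β γ : ℝ) :
    cov[f t, fun ω => α * f x ω + β * f y ω + γ * f z ω; P] =
      α * (1 - ‖hf.curve x - hf.curve t‖ ^ 2 / 2) + β * (1 - ‖hf.curve y - hf.curve t‖ ^ 2 / 2) +
        γ * (1 - ‖hf.curve z - hf.curve t‖ ^ 2 / 2) := by
  have h : ∀ s, Integrable (fun ω => f s ω * f t ω) P := fun s =>
    (hf.memLp s).integrable_mul (hf.memLp t)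
  have h2 : Integrable (fun ω => α * (f x ω * f t ω) + β * (f y ω * f t ω)) P :=
    ((h x).const_mul α).add ((h y).const_mul β)
  have h3 : MemLp (fun ω => α * f x ω + β * f y ω + γ * f z ω) 2 P :=
    (((hf.memLp x).const_mul α).add ((hf.memLp y).const_mul β)).add ((hf.memLp z).const_mul γ)
  rw [covariance_eq_sub (hf.memLp t) h3, hf.integral_combination,
    mul_zero, sub_zero, ← hf.integral_mul, ← hf.integral_mul, ← hf.integral_mul,
    ← integral_const_mul, ← integral_const_mul, ← integral_const_mul,
    ← integral_add ((h x).const_mul α) ((h y).const_mul β),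
    ← integral_add h2 ((h z).const_mul γ)]
  refine integral_congr_ae (ae_of_all _ fun ω => ?_)
  simp only [Pi.mul_apply]
  ring

end

variable {Ω : Type} {E : Type*} [MeasurableSpace Ω] [NormedAddCommGroup E] [NormedSpace ℝ E]
  [FiniteDimensional ℝ E] {P : Measure Ω} [IsProbabilityMeasure P] {f : E → Ω → ℝ}

/-- The probability that the field exceeds `b` at one of finitely many points at distance
`O(1/b)` of `t₀` while it stays below `b` at points at distance `O(η/b)` of these. -/
lemma exists_measure_crossing_le (hf : IsStationaryField P f) (R : ℝ) {l : ℝ} (hl : 0 < l) :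
    ∃ C > 0, ∃ b₁ ≥ 1, ∀ b ≥ b₁, ∀ η, 0 < η → η ≤ 1 → ∀ {ι : Type} [Fintype ι]
      (t s : ι → E) (t₀ : E), ‖t₀‖ ≤ R → (∀ i, ‖t i‖ ≤ R) → (∀ i, ‖s i‖ ≤ R) →
      (∀ i, ‖t i - t₀‖ ≤ l / b) → (∀ i, ‖s i - t₀‖ ≤ l / b) → (∀ i, ‖t i - s i‖ ≤ l * η / b) →
      P {ω | (∃ i, b < f (t i) ω) ∧ ∀ i, f (s i) ω < b} ≤
        ENNReal.ofReal (C * (η * (gaussianPDFReal 0 1 b / b))) := by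
  obtain ⟨K, hK, hPK⟩ := hf.exists_le_measure_tameEvent R
  obtain ⟨C, hC, hlip⟩ := hf.exists_lipschitz_curve
  obtain ⟨M, hM, hexp⟩ := exists_lintegral_exp_norm_le (K * (l + (C * l) ^ 2)) (by positivity)
  set A := (C * l) ^ 2 with hA
  have hA0 : 0 ≤ A := sq_nonneg _
  refine ⟨4 * (4 * A + 1) * M + 1, by positivity, max 1 (C * l), le_max_left _ _, ?_⟩
  intro b hb η hη hη1 ι _ t s t₀ ht₀ ht hs htt₀ hst₀ hts
  have hb1 : 1 ≤ b := (le_max_left _ _).trans hb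
  have hbC : C * l ≤ b := (le_max_right _ _).trans hb
  have hb0 : 0 < b := by linarith
  set D : E → ℝ := fun x => ‖hf.curve x - hf.curve t₀‖ with hD
  set r : E → ℝ := fun x => 1 - D x ^ 2 / 2 with hr
  have hD0 : ∀ x, 0 ≤ D x := fun x => norm_nonneg _
  have hDle : ∀ x, ‖x - t₀‖ ≤ l / b → D x ≤ C * l / b := fun x hx =>
    (hlip _ _).trans (by rw [mul_div_assoc]; gcongr)
  have hDsq : ∀ x, ‖x - t₀‖ ≤ l / b → D x ^ 2 ≤ A / b ^ 2 := fun x hx => by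
    rw [hA, ← div_pow]
    exact pow_le_pow_left₀ (hD0 x) (hDle x hx) 2
  have hAb : A / b ^ 2 ≤ 1 := by
    rw [hA, div_le_one (by positivity)]
    exact pow_le_pow_left₀ (by positivity) hbC 2
  have hrhalf : ∀ x, ‖x - t₀‖ ≤ l / b → 1 / 2 ≤ r x := fun x hx => by
    have := hDsq x hx
    simp only [hr]
    linarith
  have hr1 : ∀ x, r x ≤ 1 := fun x => by
    have := sq_nonneg (D x)
    simp only [hr]
    linarith
  have hrr : ∀ i, |r (t i) - r (s i)| ≤ A * η / b ^ 2 := fun i => by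
    have h1 : |D (s i) - D (t i)| ≤ C * (l * η / b) := by
      have h2 := abs_norm_sub_norm_le (hf.curve (s i) - hf.curve t₀) (hf.curve (t i) - hf.curve t₀)
      rw [sub_sub_sub_cancel_right] at h2
      refine h2.trans ((hlip _ _).trans ?_)
      rw [norm_sub_rev]
      exact mul_le_mul_of_nonneg_left (hts i) hC.le
    have h3 : r (t i) - r (s i) = (D (s i) - D (t i)) * ((D (s i) + D (t i)) / 2) := by
      simp only [hr]; ring
    have h4 : (D (s i) + D (t i)) / 2 ≤ C * l / b := by
      linarith [hDle _ (hst₀ i), hDle _ (htt₀ i)]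
    have h5 : 0 ≤ (D (s i) + D (t i)) / 2 := by linarith [hD0 (s i), hD0 (t i)]
    rw [h3, abs_mul, abs_of_nonneg h5]
    calc _ ≤ C * (l * η / b) * (C * l / b) := by gcongr
      _ = A * η / b ^ 2 := by rw [hA]; field_simp
  set Y : Ω → ι ⊕ ι → ℝ := fun ω => Sum.elim (fun i => b * (f (t i) ω - r (t i) * f t₀ ω))
    (fun i => b / η * (f (t i) ω - f (s i) ω - (r (t i) - r (s i)) * f t₀ ω)) with hY
  have hcomb : ∀ k, ∃ (x y : E) (α β γ : ℝ),
      (∀ ω, Y ω k = α * f x ω + β * f y ω + γ * f t₀ ω) ∧ α * r x + β * r y + γ = 0 := by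
    rintro (i | i)
    · exact ⟨t i, t i, b, 0, -(b * r (t i)),
        fun ω => by simp only [hY, Sum.elim_inl]; ring, by ring⟩
    · exact ⟨t i, s i, b / η, -(b / η), -(b / η * (r (t i) - r (s i))),
        fun ω => by simp only [hY, Sum.elim_inr]; ring, by ring⟩
  have hYmeas : Measurable Y := measurable_pi_lambda _ fun k => by
    have := hf.measurable
    obtain ⟨x, y, α, β, γ, h, -⟩ := hcomb k
    simp_rw [h]
    fun_prop
  have hjoint : IsGaussianProcess (Sum.elim (fun _ : Unit => f t₀) fun k ω => Y ω k) P := by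
    refine isGaussianProcess_of_combination hf.gaussian ?_
    rintro (k | k)
    · exact ⟨t₀, t₀, t₀, 1, 0, 0, fun ω => by simp⟩
    · obtain ⟨x, y, α, β, γ, h, -⟩ := hcomb k
      exact ⟨x, y, t₀, α, β, γ, h⟩
  have hYgauss : HasGaussianLaw Y P := by
    have h1 : IsGaussianProcess (fun k ω => Y ω k) P := hjoint.comp_right Sum.inr
    exact (h1.hasGaussianLaw Finset.univ).map (ContinuousLinearMap.pi fun k =>
      ContinuousLinearMap.proj (⟨k, Finset.mem_univ k⟩ : (Finset.univ : Finset (ι ⊕ ι))))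
  have hYmean : ∀ k, ∫ ω, Y ω k ∂P = 0 := fun k => by
    obtain ⟨x, y, α, β, γ, h, -⟩ := hcomb k
    simp_rw [h]
    exact hf.integral_combination _ _ _ _ _ _
  have hind : IndepFun (f t₀) Y P := by
    have h1 := hjoint.indepFun_of_covariance_eq_zero (fun _ => (hf.measurable t₀).aemeasurable)
      (fun k => ((measurable_pi_apply k).comp hYmeas).aemeasurable) fun _ k => by
        obtain ⟨x, y, α, β, γ, h, h0⟩ := hcomb k
        rw [funext h, hf.covariance_combination, sub_self, norm_zero]
        linear_combination h0
    exact h1.comp (φ := fun x : Unit → ℝ => x ()) (ψ := id) (measurable_pi_apply _) measurable_id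
  have hYtame : tameEvent f R K ⊆ {ω | ‖Y ω‖ ≤ K * (l + A)} := by
    intro ω hω
    have hf0 := hω.1 t₀ (by simpa using ht₀)
    refine (pi_norm_le_iff_of_nonneg (by positivity)).2 ?_
    rintro (i | i)
    · simp only [hY, Sum.elim_inl, Real.norm_eq_abs, abs_mul, abs_of_pos hb0]
      have h1 := (hω.2 (t i) (by simpa using ht i) t₀ (by simpa using ht₀)).trans
        (mul_le_mul_of_nonneg_left (htt₀ i) hK.le)
      have h2 : |f (t i) ω - r (t i) * f t₀ ω| ≤ K * (l / b) + A / b ^ 2 * K := by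
        calc |f (t i) ω - r (t i) * f t₀ ω| = |(f (t i) ω - f t₀ ω) + (1 - r (t i)) * f t₀ ω| := by
              congr 1; ring
          _ ≤ |f (t i) ω - f t₀ ω| + |1 - r (t i)| * |f t₀ ω| := by
              rw [← abs_mul]; exact abs_add_le _ _
          _ ≤ _ := by
              have h3 : |1 - r (t i)| ≤ A / b ^ 2 := by
                have := hDsq _ (htt₀ i)
                have := sq_nonneg (D (t i))
                rw [abs_of_nonneg (by linarith [hr1 (t i)])]
                simp only [hr]
                linarith
              gcongr
      calc b * |f (t i) ω - r (t i) * f t₀ ω| ≤ b * (K * (l / b) + A / b ^ 2 * K) := by gcongr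
        _ = K * (l + A / b) := by field_simp
        _ ≤ K * (l + A) := by gcongr; exact div_le_self hA0 hb1
    · simp only [hY, Sum.elim_inr, Real.norm_eq_abs, abs_mul, abs_of_pos (div_pos hb0 hη)]
      have h1 := (hω.2 (t i) (by simpa using ht i) (s i) (by simpa using hs i)).trans
        (mul_le_mul_of_nonneg_left (hts i) hK.le)
      have h2 : |f (t i) ω - f (s i) ω - (r (t i) - r (s i)) * f t₀ ω| ≤
          K * (l * η / b) + A * η / b ^ 2 * K := by
        refine (abs_sub _ _).trans ?_
        rw [abs_mul]
        have := hrr i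
        gcongr
      calc _ ≤ b / η * (K * (l * η / b) + A * η / b ^ 2 * K) := by gcongr
        _ = K * (l + A / b) := by field_simp
        _ ≤ K * (l + A) := by gcongr; exact div_le_self hA0 hb1
  have hφ : 0 ≤ gaussianPDFReal 0 1 b := gaussianPDFReal_nonneg _ _ _
  have key := measure_crossing_le hb1 hη.le hη1 hA0 (r := fun i => r (t i)) (q := fun i => r (s i))
    (fun i => hrhalf _ (htt₀ i)) (fun i => hr1 _) (fun i => hrhalf _ (hst₀ i)) hrr
    (hf.measurable t₀).aemeasurable hYmeas.aemeasurable (hf.map_eval t₀) hind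
  have hset : {ω | (∃ i, b < f (t i) ω) ∧ ∀ i, f (s i) ω < b} =
      {ω | (∃ i, b < r (t i) * f t₀ ω + Y ω (Sum.inl i) / b) ∧
        ∀ i, r (s i) * f t₀ ω + (Y ω (Sum.inl i) / b - η / b * Y ω (Sum.inr i)) < b} := by
    have h1 : ∀ ω i, r (t i) * f t₀ ω + Y ω (Sum.inl i) / b = f (t i) ω := fun ω i => by
      simp only [hY, Sum.elim_inl]; field_simp; ring
    have h2 : ∀ ω i, r (s i) * f t₀ ω + (Y ω (Sum.inl i) / b - η / b * Y ω (Sum.inr i)) =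
        f (s i) ω := fun ω i => by
      simp only [hY, Sum.elim_inl, Sum.elim_inr]; field_simp; ring
    simp_rw [h1, h2]
  rw [hset]
  refine key.trans ?_
  calc _ ≤ ENNReal.ofReal (4 * (4 * A + 1) * (η * (gaussianPDFReal 0 1 b / b))) *
        ENNReal.ofReal M := by
        gcongr
        exact hexp P Y hYgauss hYmean (hPK.trans (measure_mono hYtame))
    _ = ENNReal.ofReal (4 * (4 * A + 1) * (η * (gaussianPDFReal 0 1 b / b)) * M) := by
        rw [← ENNReal.ofReal_mul (by positivity)]
    _ ≤ _ := by
        apply ENNReal.ofReal_le_ofReal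
        have : 0 ≤ η * (gaussianPDFReal 0 1 b / b) := by positivity
        nlinarith

end IsStationaryField

section SecondMoment

/-- Second moment lower bound for the probability of a union. -/
lemma card_mul_le_measureReal_biUnion {Ω α : Type*} [MeasurableSpace Ω] {P : Measure Ω}
    [IsProbabilityMeasure P] {s : Finset α} {U : α → Set Ω} (hU : ∀ a, MeasurableSet (U a))
    {p l : ℝ} (hl : 0 < l) (h1 : ∀ a ∈ s, p ≤ P.real (U a))
    (h2 : ∀ a ∈ s, ∑ a' ∈ s, P.real (U a ∩ U a') ≤ l * p) :
    s.card * p ≤ l * P.real (⋃ a ∈ s, U a) := by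
  set X : Ω → ℝ := fun ω => ∑ a ∈ s, (U a).indicator 1 ω with hX
  have hint : ∀ V : Set Ω, MeasurableSet V → Integrable (V.indicator (1 : Ω → ℝ)) P := fun V hV =>
    (integrable_const (1 : ℝ)).indicator hV
  have hXint : Integrable X P := integrable_finsetSum _ fun a _ => hint _ (hU a)
  have hXX : ∀ ω, X ω ^ 2 = ∑ a ∈ s, ∑ a' ∈ s, (U a ∩ U a').indicator 1 ω := fun ω => by
    rw [hX, sq, Finset.sum_mul_sum]
    refine Finset.sum_congr rfl fun a _ => Finset.sum_congr rfl fun a' _ => ?_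
    rw [Set.inter_indicator_one]; rfl
  have hXXint : Integrable (fun ω => X ω ^ 2) P := by
    simp_rw [hXX]
    exact integrable_finsetSum _ fun a _ => integrable_finsetSum _ fun a' _ =>
      hint _ ((hU a).inter (hU a'))
  have hEX : s.card * p ≤ ∫ ω, X ω ∂P := by
    rw [hX, integral_finsetSum _ fun a _ => hint _ (hU a)]
    simp_rw [integral_indicator_one (hU _)]
    simpa using Finset.card_nsmul_le_sum s _ _ h1
  have hEXX : ∫ ω, X ω ^ 2 ∂P ≤ s.card * (l * p) := by
    simp_rw [hXX]
    rw [integral_finsetSum _ fun a _ => integrable_finsetSum _ fun a' _ =>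
      hint _ ((hU a).inter (hU a'))]
    have : ∀ a ∈ s, ∫ ω, ∑ a' ∈ s, (U a ∩ U a').indicator (1 : Ω → ℝ) ω ∂P ≤ l * p := by
      intro a ha
      rw [integral_finsetSum _ fun a' _ => hint _ ((hU a).inter (hU a'))]
      simp_rw [integral_indicator_one ((hU a).inter (hU _))]
      exact h2 a ha
    simpa using Finset.sum_le_card_nsmul s _ _ this
  have hV : MeasurableSet (⋃ a ∈ s, U a) := s.measurableSet_biUnion fun a _ => hU a
  have hle : ∫ ω, (2 / l * X ω - (1 / l) ^ 2 * X ω ^ 2) ∂P ≤ P.real (⋃ a ∈ s, U a) := by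
    rw [← integral_indicator_one hV]
    refine integral_mono ((hXint.const_mul _).sub (hXXint.const_mul _)) (hint _ hV) fun ω => ?_
    by_cases hω : ω ∈ ⋃ a ∈ s, U a
    · rw [Set.indicator_of_mem hω]
      have := sq_nonneg (1 / l * X ω - 1)
      simp only [Pi.one_apply]
      linarith [show 2 / l * X ω = 2 * (1 / l * X ω) by ring, mul_pow (1 / l) (X ω) 2]
    · rw [Set.indicator_of_notMem hω]
      have : X ω = 0 := Finset.sum_eq_zero fun a ha => Set.indicator_of_notMem
        (fun h => hω (Set.mem_biUnion ha h)) _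
      simp [this]
  rw [integral_sub (hXint.const_mul _) (hXXint.const_mul _), integral_const_mul,
    integral_const_mul] at hle
  have h3 : 2 / l * (s.card * p) - (1 / l) ^ 2 * (s.card * (l * p)) ≤ P.real (⋃ a ∈ s, U a) := by
    refine le_trans ?_ hle
    gcongr
  have h4 : 2 / l * (s.card * p) - (1 / l) ^ 2 * (s.card * (l * p)) = s.card * p / l := by
    field_simp; ring
  rw [h4, div_le_iff₀ hl] at h3
  linarith

lemma exists_sum_exp_neg_norm_le (d : ℕ) {γ : ℝ} (hγ : 0 < γ) :
    ∃ M > 0, ∀ A : Finset (Fin d → ℤ), ∑ m ∈ A, Real.exp (-(γ * ‖m‖)) ≤ M := by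
  set β := γ / (d + 1) with hβ
  have hβ0 : 0 < β := by positivity
  have hsum : Summable fun k : ℤ => Real.exp (-(β * |(k : ℝ)|)) := by
    have hnat : Summable fun n : ℕ => Real.exp (-(β * n)) := by
      have := Real.summable_exp_nat_mul_of_ge (c := -β) (by linarith) (f := fun n => (n : ℝ))
        fun i => le_rfl
      simpa using this
    refine Summable.of_nat_of_neg ?_ ?_ <;> simpa using hnat
  set M := ∑' k : ℤ, Real.exp (-(β * |(k : ℝ)|)) with hM
  have hM0 : 0 < M := hsum.tsum_pos (fun _ => (Real.exp_pos _).le) 0 (Real.exp_pos _)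
  refine ⟨M ^ d, by positivity, fun A => ?_⟩
  have hle : ∀ m : Fin d → ℤ, Real.exp (-(γ * ‖m‖)) ≤ ∏ j, Real.exp (-(β * |(m j : ℝ)|)) := by
    intro m
    rw [← Real.exp_sum, Real.exp_le_exp, Finset.sum_neg_distrib, neg_le_neg_iff, ← Finset.mul_sum]
    have h1 : ∑ j, |(m j : ℝ)| ≤ d * ‖m‖ := by
      have : ∀ j ∈ Finset.univ, |(m j : ℝ)| ≤ ‖m‖ := fun j _ => by
        rw [← Int.norm_eq_abs]; exact norm_le_pi_norm m j
      simpa using Finset.sum_le_card_nsmul _ _ _ this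
    calc β * ∑ j, |(m j : ℝ)| ≤ β * ((d + 1) * ‖m‖) := by
          gcongr
          linarith [norm_nonneg m]
      _ = γ * ‖m‖ := by rw [hβ]; field_simp
  calc ∑ m ∈ A, Real.exp (-(γ * ‖m‖)) ≤ ∑ m ∈ A, ∏ j, Real.exp (-(β * |(m j : ℝ)|)) :=
        Finset.sum_le_sum fun m _ => hle m
    _ ≤ ∑ m ∈ Fintype.piFinset (fun j => A.image fun m' : Fin d → ℤ => m' j),
          ∏ j, Real.exp (-(β * |(m j : ℝ)|)) := by
        refine Finset.sum_le_sum_of_subset_of_nonneg (fun m hm => ?_)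
          fun m _ _ => Finset.prod_nonneg fun j _ => (Real.exp_pos _).le
        exact Fintype.mem_piFinset.2 fun j => Finset.mem_image_of_mem _ hm
    _ = ∏ j, ∑ k ∈ (A.image fun m' : Fin d → ℤ => m' j), Real.exp (-(β * |(k : ℝ)|)) :=
        (Finset.prod_univ_sum _ fun _ (k : ℤ) => Real.exp (-(β * |(k : ℝ)|))).symm
    _ ≤ ∏ _j : Fin d, M := Finset.prod_le_prod
        (fun j _ => Finset.sum_nonneg fun k _ => (Real.exp_pos _).le)
        fun j _ => hsum.sum_le_tsum _ fun k _ => (Real.exp_pos _).le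
    _ = M ^ d := by simp

end SecondMoment

namespace IsStationaryField

variable {Ω E : Type*} [MeasurableSpace Ω] [NormedAddCommGroup E]
  {P : Measure Ω} {f : E → Ω → ℝ}

lemma measure_inter_lt_le (hf : IsStationaryField P f) {b : ℝ} (hb : 0 < b) (s t : E) :
    P.real ({ω | b < f s ω} ∩ {ω | b < f t ω}) ≤ gaussianPDFReal 0 1 b / b *
      Real.exp (-((b * ‖hf.curve s - hf.curve t‖) ^ 2 / 8)) := by
  have hφ : 0 ≤ gaussianPDFReal 0 1 b := gaussianPDFReal_nonneg _ _ _
  set D := ‖hf.curve s - hf.curve t‖ with hD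
  have hD2 : D ≤ 2 := hf.norm_curve_sub_le_two s t
  have hD4 : D ^ 2 ≤ 4 := by nlinarith [norm_nonneg (hf.curve s - hf.curve t)]
  have h1 := gaussianReal_Ioi_two_mul_le (v := (4 - D ^ 2).toNNReal) (sq_nonneg D)
    (Real.coe_toNNReal _ (by linarith)) hb
  rw [← hf.map_add, Measure.map_apply (by have := hf.measurable; fun_prop) measurableSet_Ioi] at h1
  rw [mul_pow]
  refine ENNReal.toReal_le_of_le_ofReal (by positivity) (le_trans (measure_mono ?_) h1)
  rintro ω ⟨h2, h3⟩
  simp only [Set.mem_ofPred_eq] at h2 h3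
  simp only [Set.mem_preimage, Set.mem_Ioi]
  linarith

/-- If the values of the field at the points `t a` decorrelate at rate `c / b` in the lattice
distance, the exceedances of `b` at these points are essentially disjoint. -/
lemma exists_card_mul_le [IsProbabilityMeasure P] (hf : IsStationaryField P f) (d : ℕ)
    {c : ℝ} (hc : 0 < c) :
    ∃ C > 0, ∀ b ≥ 1, ∀ (A : Finset (Fin d → ℤ)) (t : (Fin d → ℤ) → E),
      (∀ a ∈ A, ∀ a' ∈ A, c * (‖a - a'‖ - 1) ≤ b * ‖hf.curve (t a) - hf.curve (t a')‖) →
      A.card * (gaussianPDFReal 0 1 b / b) ≤ C * P.real (⋃ a ∈ A, {ω | b < f (t a) ω}) := by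
  set γ := c ^ 2 / 8 with hγ
  have hγ0 : 0 < γ := by positivity
  obtain ⟨M, hM, hsum⟩ := exists_sum_exp_neg_norm_le d hγ0
  set l := Real.exp (3 / 2) * (Real.exp (γ * (5 / 4)) * M) with hl
  have hl0 : 0 < l := by positivity
  refine ⟨Real.exp (3 / 2) * l, by positivity, fun b hb A t ht => ?_⟩
  have hb0 : 0 < b := by linarith
  have hφ : 0 ≤ gaussianPDFReal 0 1 b := gaussianPDFReal_nonneg _ _ _
  set q := gaussianPDFReal 0 1 b / b with hq
  have hq0 : 0 ≤ q := by positivity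
  have hexp : Real.exp (3 / 2) * Real.exp (-(3 / 2)) = 1 := by rw [← Real.exp_add]; simp
  have key := card_mul_le_measureReal_biUnion (P := P) (s := A) (U := fun a => {ω | b < f (t a) ω})
    (fun a => measurableSet_lt measurable_const (hf.measurable _))
    (p := Real.exp (-(3 / 2)) * q) hl0 (fun a _ => ?_) fun a ha => ?_
  · calc A.card * q = Real.exp (3 / 2) * (A.card * (Real.exp (-(3 / 2)) * q)) := by
          linear_combination (-(A.card * q)) * hexp
      _ ≤ Real.exp (3 / 2) * (l * P.real (⋃ a ∈ A, {ω | b < f (t a) ω})) := by gcongr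
      _ = _ := by ring
  · have h1 := le_gaussianReal_Ioi hb
    rw [← hf.map_eval (t a), Measure.map_apply (hf.measurable _) measurableSet_Ioi,
      ENNReal.ofReal_le_iff_le_toReal (measure_ne_top _ _)] at h1
    exact h1
  · have hterm : ∀ a' ∈ A, P.real ({ω | b < f (t a) ω} ∩ {ω | b < f (t a') ω}) ≤
        q * Real.exp (γ * (5 / 4)) * Real.exp (-(γ * ‖a - a'‖)) := by
      intro a' ha'
      refine (hf.measure_inter_lt_le hb0 _ _).trans ?_
      rw [mul_assoc, ← Real.exp_add]
      refine mul_le_mul_of_nonneg_left (Real.exp_le_exp.2 ?_) hq0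
      have h1 := ht a ha a' ha'
      set D := b * ‖hf.curve (t a) - hf.curve (t a')‖ with hD
      have hD0 : 0 ≤ D := by positivity
      have h2 : c ^ 2 * (‖a - a'‖ - 5 / 4) ≤ D ^ 2 := by
        rcases le_or_gt 1 ‖a - a'‖ with h | h
        · have h3 := pow_le_pow_left₀ (mul_nonneg hc.le (by linarith)) h1 2
          nlinarith [mul_nonneg (sq_nonneg c) (sq_nonneg (‖a - a'‖ - 3 / 2))]
        · nlinarith [sq_nonneg D, sq_nonneg c]
      rw [hγ]
      linarith
    refine (Finset.sum_le_sum hterm).trans ?_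
    rw [← Finset.mul_sum]
    have h5 : ∑ a' ∈ A, Real.exp (-(γ * ‖a - a'‖)) ≤ M := by
      have := hsum (A.image fun a' => a - a')
      rwa [Finset.sum_image fun x _ y _ h => sub_right_injective h] at this
    calc q * Real.exp (γ * (5 / 4)) * ∑ a' ∈ A, Real.exp (-(γ * ‖a - a'‖))
        ≤ q * Real.exp (γ * (5 / 4)) * M := by gcongr
      _ = l * (Real.exp (-(3 / 2)) * q) := by
          rw [hl]; linear_combination (-(q * Real.exp (γ * (5 / 4)) * M)) * hexp

end IsStationaryField

lemma norm_floor_sub_floor_le {d : ℕ} (x y : Fin d → ℝ) :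
    ‖(fun j => ⌊x j⌋) - fun j => ⌊y j⌋‖ ≤ ‖x - y‖ + 1 := by
  refine (pi_norm_le_iff_of_nonneg (by positivity)).2 fun j => ?_
  have h1 : |x j - y j| ≤ ‖x - y‖ := norm_le_pi_norm (x - y) j
  rw [Pi.sub_apply, Int.norm_eq_abs, Int.cast_sub]
  have := abs_le.1 h1
  rw [abs_le]
  constructor <;> linarith [Int.floor_le (x j), Int.lt_floor_add_one (x j), Int.floor_le (y j),
    Int.lt_floor_add_one (y j)]

lemma norm_sub_le_one_of_floor_eq {d : ℕ} {x y : Fin d → ℝ}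
    (h : (fun j => ⌊x j⌋) = fun j => ⌊y j⌋) : ‖x - y‖ ≤ 1 :=
  (pi_norm_le_iff_of_nonneg zero_le_one).2 fun j =>
    (Int.abs_sub_lt_one_of_floor_eq_floor (congrFun h j)).le

lemma finite_image_floor {d : ℕ} {Q : Set (Fin d → ℝ)} {R : ℝ} (hQ : ∀ x ∈ Q, ‖x‖ ≤ R) :
    ((fun (x : Fin d → ℝ) j => ⌊x j⌋) '' Q).Finite := by
  refine (Set.finite_Icc (fun _ : Fin d => ⌊-R⌋) fun _ => ⌊R⌋).subset ?_
  rintro _ ⟨x, hx, rfl⟩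
  have h : ∀ j, |x j| ≤ R := fun j => (norm_le_pi_norm x j).trans (hQ x hx)
  exact ⟨fun j => Int.floor_mono (abs_le.1 (h j)).1, fun j => Int.floor_mono (abs_le.1 (h j)).2⟩

namespace IsStationaryField

variable {Ω : Type} [MeasurableSpace Ω]
  {P : Measure Ω} [IsProbabilityMeasure P]

/-- Countable version of `exists_measure_crossing_le`, with distances measured through a projection
along which the field factors. -/
lemma exists_measure_cell_le {E : Type*} [NormedAddCommGroup E] [NormedSpace ℝ E]
    [FiniteDimensional ℝ E] {f : E → Ω → ℝ} (hf : IsStationaryField P f) {π : E →ₗ[ℝ] E}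
    (hπ : ∀ s h, hf.curve (s + h) = hf.curve (s + π h)) (R : ℝ) :
    ∃ C > 0, ∃ b₁ ≥ 1, ∀ b ≥ b₁, ∀ η, 0 < η → η ≤ 1 → ∀ (S : Finset E) (Q : Set E) (t₀ : E),
      Q.Countable → ‖t₀‖ ≤ R → (∀ t ∈ Q, ‖π (t - t₀)‖ ≤ 1 / b) →
      (∀ t ∈ Q, ∃ s ∈ S, ‖s - t‖ ≤ 2 * η / b) →
      P {ω | (∃ t ∈ Q, b < f t ω) ∧ ∀ s ∈ S, f s ω < b} ≤
        ENNReal.ofReal (C * (η * (gaussianPDFReal 0 1 b / b))) := by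
  set N := ‖π.toContinuousLinearMap‖ with hN
  have hN0 : 0 ≤ N := norm_nonneg _
  have hπN : ∀ h, ‖π h‖ ≤ N * ‖h‖ := π.toContinuousLinearMap.le_opNorm
  set l := 1 + 2 * N with hl
  have hl0 : 0 < l := by positivity
  obtain ⟨C, hC, b₁, hb₁, key⟩ := hf.exists_measure_crossing_le (R + l) hl0
  refine ⟨C, hC, b₁, hb₁, fun b hb η hη hη1 S Q t₀ hQc ht₀ hQ hS => ?_⟩
  have hb1 : 1 ≤ b := le_trans hb₁ hb
  have hb0 : 0 < b := by linarith
  rcases Q.eq_empty_or_nonempty with rfl | hQne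
  · simp
  obtain ⟨x, rfl⟩ := hQc.exists_eq_range hQne
  simp only [Set.mem_range, exists_exists_eq_and, forall_exists_index, forall_apply_eq_imp_iff]
    at hQ hS ⊢
  choose s hsS hs using hS
  set W : ℕ → Set Ω := fun n => {ω | (∃ i < n, b < f (x i) ω) ∧ ∀ s ∈ S, f s ω < b} with hW
  have hWmono : Monotone W := by
    rintro m n hmn ω ⟨⟨i, hi, h⟩, h'⟩
    exact ⟨⟨i, hi.trans_le hmn, h⟩, h'⟩
  have hsub : {ω | (∃ i, b < f (x i) ω) ∧ ∀ s ∈ S, f s ω < b} ⊆ ⋃ n, W n := by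
    rintro ω ⟨⟨i, h⟩, h'⟩
    exact Set.mem_iUnion.2 ⟨i + 1, ⟨i, i.lt_succ_self, h⟩, h'⟩
  refine (measure_mono hsub).trans ?_
  rw [hWmono.measure_iUnion]
  refine iSup_le fun n => ?_
  set g : E → E := fun y => t₀ + π (y - t₀) with hg
  have hgsub : ∀ y, g y - t₀ = π (y - t₀) := fun y => add_sub_cancel_left _ _
  have hgg : ∀ i, ‖g (x i) - g (s i)‖ ≤ N * (2 * η / b) := fun i => by
    have h1 : g (x i) - g (s i) = π (x i - s i) := by
      simp only [hg, add_sub_add_left_eq_sub]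
      rw [← _root_.map_sub, sub_sub_sub_cancel_right]
    rw [h1]
    refine (hπN _).trans ?_
    rw [norm_sub_rev]
    exact mul_le_mul_of_nonneg_left (hs i) hN0
  have hηb : N * (2 * η / b) ≤ 2 * N / b := by
    rw [mul_div_assoc', show N * (2 * η) = 2 * N * η by ring]
    exact div_le_div_of_nonneg_right (mul_le_of_le_one_right (by positivity) hη1) hb0.le
  have hlb : l / b = 1 / b + 2 * N / b := by rw [hl, add_div]
  have hgx : ∀ i, ‖g (x i) - t₀‖ ≤ l / b := fun i => by
    rw [hgsub]
    have : 0 ≤ 2 * N / b := by positivity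
    linarith [hQ i]
  have hgs : ∀ i, ‖g (s i) - t₀‖ ≤ l / b := fun i => by
    have h1 := norm_sub_le_norm_sub_add_norm_sub (g (s i)) (g (x i)) t₀
    rw [norm_sub_rev (g (s i)) (g (x i)), hgsub (x i)] at h1
    linarith [hgg i, hQ i]
  have hR : ∀ y, ‖g y - t₀‖ ≤ l / b → ‖g y‖ ≤ R + l := fun y hy => by
    have h1 := norm_le_norm_add_norm_sub' (g y) t₀
    have h2 : l / b ≤ l := div_le_self hl0.le hb1
    linarith
  have hae : ∀ y, ∀ᵐ ω ∂P, f y ω = f (g y) ω := fun y => by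
    refine hf.ae_eq_of_curve_eq ?_
    have := hπ t₀ (y - t₀)
    rwa [add_sub_cancel] at this
  refine le_trans (measure_mono_ae ?_) (key b hb η hη hη1 (fun i : Fin n => g (x i))
    (fun i => g (s i)) t₀ (by linarith) (fun i => hR _ (hgx i)) (fun i => hR _ (hgs i))
    (fun i => hgx i) (fun i => hgs i) fun i => (hgg i).trans ?_)
  · filter_upwards [ae_all_iff.2 fun i => hae (x i), ae_all_iff.2 fun i => hae (s i)] with ω h1 h2
    rintro ⟨⟨i, hi, h⟩, h'⟩
    exact ⟨⟨⟨i, hi⟩, (h1 i).symm ▸ h⟩, fun j => (h2 j).symm ▸ h' _ (hsS j)⟩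
  · rw [mul_div_assoc', show N * (2 * η) = 2 * N * η by ring]
    gcongr
    linarith

variable {d : ℕ} {f : (Fin d → ℝ) → Ω → ℝ}

/-- On a small piece, the probability of an undetected exceedance is at most `O(η)` times the
probability of an exceedance. -/
lemma exists_measure_piece_le (hf : IsStationaryField P f)
    {π : (Fin d → ℝ) →ₗ[ℝ] (Fin d → ℝ)} {c ρ : ℝ} (hc : 0 < c)
    (hπ : ∀ s h, hf.curve (s + h) = hf.curve (s + π h))
    (hlow : ∀ h, ‖π h‖ ≤ ρ → c * ‖π h‖ ≤ ‖hf.curve h - hf.curve 0‖) (R : ℝ) :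
    ∃ C > 0, ∃ b₁ ≥ 1, ∀ b ≥ b₁, ∀ η, 0 < η → η ≤ 1 → ∀ (S : Finset (Fin d → ℝ))
      (Q : Set (Fin d → ℝ)), Q.Countable → (∀ t ∈ Q, ‖t‖ ≤ R) →
      (∀ t ∈ Q, ∀ t' ∈ Q, ‖π (t - t')‖ ≤ ρ) → (∀ t ∈ Q, ∃ s ∈ S, ‖s - t‖ ≤ 2 * η / b) →
      P {ω | (∃ t ∈ Q, b < f t ω) ∧ ∀ s ∈ S, f s ω < b} ≤
        ENNReal.ofReal (C * (η * P.real {ω | ∃ t ∈ Q, b < f t ω})) := by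
  obtain ⟨C, hC, b₁, hb₁, hcell⟩ := hf.exists_measure_cell_le hπ R
  obtain ⟨C', hC', hcard⟩ := hf.exists_card_mul_le d hc
  refine ⟨C * C', by positivity, b₁, hb₁, fun b hb η hη hη1 S Q hQc hQR hQρ hQS => ?_⟩
  have hb1 : 1 ≤ b := le_trans hb₁ hb
  have hb0 : 0 < b := by linarith
  set idx : (Fin d → ℝ) → Fin d → ℤ := fun t j => ⌊(b • π t) j⌋ with hidx
  have hfin : (idx '' Q).Finite := by
    have := finite_image_floor (Q := (fun t => b • π t) '' Q)
      (R := b * (‖π.toContinuousLinearMap‖ * R)) (by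
        rintro _ ⟨t, ht, rfl⟩
        rw [norm_smul, Real.norm_of_nonneg hb0.le]
        have h1 := π.toContinuousLinearMap.le_opNorm t
        have h2 := hQR t ht
        gcongr
        exact h1.trans (by gcongr))
    rwa [Set.image_image] at this
  set A : Finset (Fin d → ℤ) := hfin.toFinset with hA
  have hmemA : ∀ a ∈ A, ∃ t ∈ Q, idx t = a := fun a ha => (hfin.mem_toFinset).1 ha
  choose! p hpQ hpidx using hmemA
  have hscale : ∀ s t, ‖b • π s - b • π t‖ = b * ‖π (s - t)‖ := fun s t => by
    rw [← smul_sub, ← _root_.map_sub, norm_smul, Real.norm_of_nonneg hb0.le]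
  have hcardA := hcard b hb1 A p fun a ha a' ha' => by
    have h1 := norm_floor_sub_floor_le (b • π (p a)) (b • π (p a'))
    have h2 : ‖a - a'‖ ≤ b * ‖π (p a - p a')‖ + 1 := by
      rw [hscale] at h1
      have h2 : ‖idx (p a) - idx (p a')‖ ≤ b * ‖π (p a - p a')‖ + 1 := h1
      rwa [hpidx a ha, hpidx a' ha'] at h2
    have h3 := hlow _ (hQρ _ (hpQ a ha) _ (hpQ a' ha'))
    rw [hf.norm_curve_sub]
    calc c * (‖a - a'‖ - 1) ≤ c * (b * ‖π (p a - p a')‖) := by gcongr; linarith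
      _ = b * (c * ‖π (p a - p a')‖) := by ring
      _ ≤ _ := by gcongr
  have hU : P.real (⋃ a ∈ A, {ω | b < f (p a) ω}) ≤ P.real {ω | ∃ t ∈ Q, b < f t ω} := by
    refine measureReal_mono fun ω hω => ?_
    obtain ⟨a, ha, h⟩ := Set.mem_iUnion₂.1 hω
    exact ⟨p a, hpQ a ha, h⟩
  have hφ : 0 ≤ gaussianPDFReal 0 1 b := gaussianPDFReal_nonneg _ _ _
  calc P {ω | (∃ t ∈ Q, b < f t ω) ∧ ∀ s ∈ S, f s ω < b}
      ≤ P (⋃ a ∈ A, {ω | (∃ t ∈ Q ∩ {t | idx t = a}, b < f t ω) ∧ ∀ s ∈ S, f s ω < b}) := by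
        refine measure_mono ?_
        rintro ω ⟨⟨t, ht, h⟩, h'⟩
        exact Set.mem_biUnion (hfin.mem_toFinset.2 ⟨t, ht, rfl⟩) ⟨⟨t, ⟨ht, rfl⟩, h⟩, h'⟩
    _ ≤ ∑ a ∈ A, P {ω | (∃ t ∈ Q ∩ {t | idx t = a}, b < f t ω) ∧ ∀ s ∈ S, f s ω < b} :=
        measure_biUnion_finset_le _ _
    _ ≤ ∑ a ∈ A, ENNReal.ofReal (C * (η * (gaussianPDFReal 0 1 b / b))) := by
        refine Finset.sum_le_sum fun a ha => ?_
        refine hcell b hb η hη hη1 S _ (p a) (hQc.mono Set.inter_subset_left) (hQR _ (hpQ a ha))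
          (fun t ht => ?_) fun t ht => hQS t ht.1
        have h1 := norm_sub_le_one_of_floor_eq (x := b • π t) (y := b • π (p a))
          (ht.2.trans (hpidx a ha).symm)
        rw [hscale] at h1
        rw [le_div_iff₀ hb0]
        linarith
    _ = ENNReal.ofReal (A.card * (C * (η * (gaussianPDFReal 0 1 b / b)))) := by
        rw [Finset.sum_const, nsmul_eq_mul, ENNReal.ofReal_mul (Nat.cast_nonneg _),
          ENNReal.ofReal_natCast]
    _ ≤ _ := by
        apply ENNReal.ofReal_le_ofReal
        calc A.card * (C * (η * (gaussianPDFReal 0 1 b / b)))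
            = C * η * (A.card * (gaussianPDFReal 0 1 b / b)) := by ring
          _ ≤ C * η * (C' * P.real {ω | ∃ t ∈ Q, b < f t ω}) := by
              have := hcardA.trans (mul_le_mul_of_nonneg_left hU hC'.le)
              gcongr
          _ = _ := by ring

/-- The probability that an exceedance of `b` on a compact set is missed by a discretization of mesh
`2η/b` is at most `O(η)` times the probability of an exceedance. -/
lemma exists_measureReal_missed_le (hf : IsStationaryField P f) {T : Set (Fin d → ℝ)}
    (hT : IsCompact T) :
    ∃ C > 0, ∃ b₁ ≥ 1, ∀ b ≥ b₁, ∀ η, 0 < η → η ≤ 1 → ∀ S : Finset (Fin d → ℝ),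
      (∀ t ∈ T, ∃ s ∈ S, ‖s - t‖ ≤ 2 * η / b) →
      P.real ({ω | ∀ s ∈ S, f s ω < b} ∩ {ω | ∃ t ∈ T, f t ω > b}) ≤
        C * η * P.real {ω | ∃ t ∈ T, f t ω > b} := by
  obtain ⟨L, hL, hlip⟩ := hf.exists_lipschitz_curve
  obtain ⟨π, c, hc, ρ, hρ, hπ, hlow⟩ :=
    exists_linearMap_of_stationary hf.norm_curve_add_sub hL hlip
  obtain ⟨R, hR⟩ := hT.isBounded.exists_norm_le
  obtain ⟨C, hC, b₁, hb₁, hpiece⟩ := hf.exists_measure_piece_le hc hπ hlow R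
  set N := ‖π.toContinuousLinearMap‖ with hN
  have hN0 : 0 ≤ N := norm_nonneg _
  set e := ρ / (2 * (N + 1)) with he
  have he0 : 0 < e := by positivity
  obtain ⟨X, -, hXfin, hXT⟩ := hT.finite_cover_balls he0
  obtain ⟨D, hDT, hDc, hTD⟩ :=
    (TopologicalSpace.IsSeparable.of_separableSpace T).exists_countable_dense_subset
  refine ⟨hXfin.toFinset.card * C + 1, by positivity, b₁, hb₁, fun b hb η hη hη1 S hS => ?_⟩
  set p := P.real {ω | ∃ t ∈ T, f t ω > b} with hp
  have hp0 : 0 ≤ p := measureReal_nonneg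
  have hρQ : ∀ x, ∀ t ∈ D ∩ Metric.ball x e, ∀ t' ∈ D ∩ Metric.ball x e, ‖π (t - t')‖ ≤ ρ := by
    rintro x t ⟨-, ht⟩ t' ⟨-, ht'⟩
    have h1 : ‖t - t'‖ ≤ 2 * e := by
      rw [← dist_eq_norm]
      linarith [dist_triangle_right t t' x, Metric.mem_ball.1 ht, Metric.mem_ball.1 ht']
    calc ‖π (t - t')‖ ≤ N * ‖t - t'‖ := π.toContinuousLinearMap.le_opNorm _
      _ ≤ (N + 1) * (2 * e) := by gcongr; linarith
      _ = ρ := by rw [he]; field_simp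
  have hpc : ∀ x ∈ hXfin.toFinset,
      P {ω | (∃ t ∈ D ∩ Metric.ball x e, b < f t ω) ∧ ∀ s ∈ S, f s ω < b} ≤
        ENNReal.ofReal (C * (η * p)) := fun x _ => by
    refine (hpiece b hb η hη hη1 S (D ∩ Metric.ball x e) (hDc.mono Set.inter_subset_left)
      (fun t ht => hR t (hDT ht.1)) (hρQ x) fun t ht => hS t (hDT ht.1)).trans ?_
    have h1 : P.real {ω | ∃ t ∈ D ∩ Metric.ball x e, b < f t ω} ≤ p :=
      measureReal_mono fun ω ⟨t, ht, h⟩ => ⟨t, hDT ht.1, h⟩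
    gcongr
  refine ENNReal.toReal_le_of_le_ofReal (by positivity) ?_
  calc P ({ω | ∀ s ∈ S, f s ω < b} ∩ {ω | ∃ t ∈ T, f t ω > b})
      ≤ P (⋃ x ∈ hXfin.toFinset,
          {ω | (∃ t ∈ D ∩ Metric.ball x e, b < f t ω) ∧ ∀ s ∈ S, f s ω < b}) := by
        refine measure_mono_ae ?_
        filter_upwards [hf.locallyLipschitz] with ω hω
        rintro ⟨hlt, t, ht, hbt⟩
        obtain ⟨x, hx, htx⟩ := Set.mem_iUnion₂.1 (hXT ht)
        obtain ⟨t', ⟨hbt', htx'⟩, ht'⟩ := mem_closure_iff.1 (hTD ht)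
          ({t | b < f t ω} ∩ Metric.ball x e)
          ((isOpen_lt continuous_const hω.continuous).inter Metric.isOpen_ball) ⟨hbt, htx⟩
        exact Set.mem_biUnion (hXfin.mem_toFinset.2 hx) ⟨⟨t', ⟨ht', htx'⟩, hbt'⟩, hlt⟩
    _ ≤ ∑ x ∈ hXfin.toFinset,
          P {ω | (∃ t ∈ D ∩ Metric.ball x e, b < f t ω) ∧ ∀ s ∈ S, f s ω < b} :=
        measure_biUnion_finset_le _ _
    _ ≤ ∑ x ∈ hXfin.toFinset, ENNReal.ofReal (C * (η * p)) := Finset.sum_le_sum hpc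
    _ = ENNReal.ofReal (hXfin.toFinset.card * (C * (η * p))) := by
        rw [Finset.sum_const, nsmul_eq_mul, ENNReal.ofReal_mul (Nat.cast_nonneg _),
          ENNReal.ofReal_natCast]
    _ ≤ _ := by
        apply ENNReal.ofReal_le_ofReal
        have : 0 ≤ η * p := by positivity
        linarith

end IsStationaryField

lemma nrm_sub_le {d : ℕ} (x y z : Fin d → ℝ) : nrm (x - z) ≤ nrm (x - y) + nrm (y - z) := by
  rw [nrm, nrm, nrm, ← Finset.sum_add_distrib]
  exact Finset.sum_le_sum fun j _ => abs_sub_le (x j) (y j) (z j)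

lemma nrm_sub_comm {d : ℕ} (x y : Fin d → ℝ) : nrm (x - y) = nrm (y - x) :=
  Finset.sum_congr rfl fun j _ => abs_sub_comm (x j) (y j)

lemma continuous_nrm {d : ℕ} : Continuous (nrm : (Fin d → ℝ) → ℝ) := by
  unfold nrm
  fun_prop

lemma norm_le_nrm {d : ℕ} (x : Fin d → ℝ) : ‖x‖ ≤ nrm x :=
  (pi_norm_le_iff_of_nonneg (Finset.sum_nonneg fun _ _ => abs_nonneg _)).2 fun j =>
    Finset.single_le_sum (f := fun j => |x j|) (fun _ _ => abs_nonneg _) (Finset.mem_univ j)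

/-- Volume bound for the size of a separated subset of a compact set of non-degenerate volume. -/
lemma card_mul_le_volume {d : ℕ} {T : Set (Fin d → ℝ)} (hT : IsCompact T) {κ θ : ℝ} (hθ : 0 < θ)
    (hθ1 : θ < 1)
    (hκ : ∀ t ∈ T, ∀ ε : ℝ, 0 < ε → ε < 1 →
      κ * ε ^ d ≤ (volume ({s | nrm (s - t) ≤ ε} ∩ T)).toReal)
    {S : Finset (Fin d → ℝ)} (hST : ↑S ⊆ T)
    (hS : ∀ s ∈ S, ∀ t ∈ S, s ≠ t → θ ≤ nrm (s - t)) :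
    S.card * (κ * (θ / 3) ^ d) ≤ (volume T).toReal := by
  have hclosed : ∀ t, IsClosed ({s | nrm (s - t) ≤ θ / 3} ∩ T) := fun t =>
    (isClosed_le (continuous_nrm.comp (continuous_id.sub continuous_const))
      continuous_const).inter hT.isClosed
  have hdisj : (S : Set (Fin d → ℝ)).PairwiseDisjoint
      fun t => {s | nrm (s - t) ≤ θ / 3} ∩ T := by
    refine fun s hs t ht hst => Set.disjoint_left.2 fun x hxs hxt => ?_
    have h1 : nrm (x - s) ≤ θ / 3 := hxs.1
    have h2 : nrm (x - t) ≤ θ / 3 := hxt.1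
    linarith [hS s hs t ht hst, nrm_sub_le s x t, nrm_sub_comm s x]
  have hfin : volume T ≠ ⊤ := hT.measure_lt_top.ne
  calc S.card * (κ * (θ / 3) ^ d) = ∑ t ∈ S, κ * (θ / 3) ^ d := by simp
    _ ≤ ∑ t ∈ S, volume.real ({s | nrm (s - t) ≤ θ / 3} ∩ T) :=
        Finset.sum_le_sum fun t ht => hκ t (hST ht) _ (by linarith) (by linarith)
    _ = volume.real (⋃ t ∈ S, {s | nrm (s - t) ≤ θ / 3} ∩ T) :=
        (measureReal_biUnion_finset hdisj (fun t _ => (hclosed t).measurableSet)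
          fun t _ => measure_ne_top_of_subset Set.inter_subset_right hfin).symm
    _ ≤ (volume T).toReal :=
        measureReal_mono (Set.iUnion₂_subset fun _ _ => Set.inter_subset_right) hfin

/-- Proposition `PropRelBias`.  Under Conditions B1–B2 there exist
constants `c₀, c₁, b₀, ε₀ > 0` such that for every `ε ∈ (0,ε₀]`, every `b > b₀` and every
finite `(ε/b)`-regular discretization `T̃` of `T`:
(i) `P(sup_{t∈T̃} f(t) < b | sup_{t∈T} f(t) > b) ≤ c₀ √ε`, and
(ii) `#(T̃) ≤ c₁ m(T) ε^{−d} b^d`. -/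
theorem regular_discretization_bias_and_cardinality
    {Ω : Type} [MeasureSpace Ω] [IsProbabilityMeasure (ℙ : Measure Ω)]
    {d : ℕ} (hd : 0 < d)
    -- Condition B2: `T` is a compact convex `d`-dimensional set with nonempty interior,
    -- containing `0`, whose boundary is a `(d−1)`-dimensional manifold without boundary,
    -- and which has non-degenerate volume near every point
    (T : Set (Fin d → ℝ)) (hTcompact : IsCompact T) (hTconv : Convex ℝ T)
    (hTint : (interior T).Nonempty) (h0T : (0 : Fin d → ℝ) ∈ T)
    (hTbdry : Nonempty (frontier T ≃ₜ Metric.sphere (0 : EuclideanSpace ℝ (Fin d)) 1))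
    (κ₀ : ℝ) (hκ₀ : 0 < κ₀)
    (hB2 : ∀ t ∈ T, ∀ ε : ℝ, 0 < ε → ε < 1 →
      κ₀ * ε ^ d ≤ (volume ({s | nrm (s - t) ≤ ε} ∩ T)).toReal)
    -- Condition B1: `f` is a centered, unit-variance, homogeneous Gaussian field,
    -- almost surely twice continuously differentiable
    (f : (Fin d → ℝ) → Ω → ℝ) (hfmeas : ∀ t, Measurable (f t))
    (hGauss : ∀ (n : ℕ) (t : Fin n → (Fin d → ℝ)) (c : Fin n → ℝ),
      ∃ v : NNReal,
        Measure.map (fun ω => ∑ i, c i * f (t i) ω) (ℙ : Measure Ω) = gaussianReal 0 v)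
    (hvar : (∫ ω, (f 0 ω) ^ 2) = 1)
    (hstat : ∀ (n : ℕ) (t : Fin n → (Fin d → ℝ)) (h : Fin d → ℝ),
      Measure.map (fun ω (i : Fin n) => f (t i + h) ω) (ℙ : Measure Ω) =
        Measure.map (fun ω (i : Fin n) => f (t i) ω) (ℙ : Measure Ω))
    (hsmooth : ∀ᵐ ω ∂(ℙ : Measure Ω), ContDiff ℝ 2 (fun t => f t ω))
    -- nondegeneracy: the global maximum over `T` is a.s. attained at a unique point
    (huniq : ∀ᵐ ω ∂(ℙ : Measure Ω), ∃! t, t ∈ T ∧ ∀ s ∈ T, f s ω ≤ f t ω)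
    :
    ∃ c₀ c₁ b₀ ε₀ : ℝ, 0 < c₀ ∧ 0 < c₁ ∧ 0 < b₀ ∧ 0 < ε₀ ∧
      ∀ ε : ℝ, 0 < ε → ε ≤ ε₀ → ∀ b : ℝ, b₀ < b →
        ∀ S : Finset (Fin d → ℝ), IsRegularDiscretization T (ε / b) S →
          ((ℙ ({ω | ∀ t ∈ S, f t ω < b} ∩ {ω | ∃ t ∈ T, f t ω > b})).toReal /
              (ℙ {ω | ∃ t ∈ T, f t ω > b}).toReal
            ≤ c₀ * Real.sqrt ε) ∧
          ((S.card : ℝ) ≤ c₁ * (volume T).toReal * b ^ d / ε ^ d) := by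
  have hf := isStationaryField_of_law hfmeas hGauss hvar hstat hsmooth
  obtain ⟨C, hC, b₁, hb₁, hmiss⟩ := hf.exists_measureReal_missed_le hTcompact
  refine ⟨C, 3 ^ d / κ₀, b₁, 1, hC, by positivity, by linarith, one_pos,
    fun ε hε hε1 b hb S hS => ⟨?_, ?_⟩⟩
  · have h1 := hmiss b hb.le ε hε hε1 S fun t ht => by
      obtain ⟨s, hs, hst⟩ := hS.2.2 t ht
      exact ⟨s, hs, (norm_le_nrm _).trans (hst.trans_eq (mul_div_assoc 2 ε b).symm)⟩
    have h2 : C * ε ≤ C * √ε :=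
      mul_le_mul_of_nonneg_left (Real.le_sqrt_of_sq_le (by nlinarith)) hC.le
    exact (div_le_of_le_mul₀ measureReal_nonneg (by positivity) h1).trans h2
  · have hb0 : 0 < b := by linarith
    have h1 := card_mul_le_volume hTcompact (div_pos hε hb0)
      ((div_lt_one hb0).2 (by linarith)) hB2 hS.1 hS.2.1
    calc (S.card : ℝ) = 3 ^ d / κ₀ * (S.card * (κ₀ * (ε / b / 3) ^ d)) * b ^ d / ε ^ d := by
          rw [div_pow, div_pow]
          field_simp
      _ ≤ 3 ^ d / κ₀ * (volume T).toReal * b ^ d / ε ^ d := by gcongr
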